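/- arXiv:2406.05777 — 9 statements merged into one kernel-verified Lean document; each statement's English description precedes it below -/
import Mathlib

section
/- Let H be a complex Hilbert space, A a bounded normal operator on H (i.e., A A* = A* A), and g ∈ H. Then A is K(A,g)-reduced if and only if A* g belongs to the closure of K(A,g). -/
/-- The Krylov subspace `K(A,g) = span {g, Ag, A²g, ...}`. -/
def krylov {H : Type*} [NormedAddCommGroup H] [InnerProductSpace ℂ H]
    (A : H →L[ℂ] H) (g : H) : Submodule ℂ H :=
  Submodule.span ℂ (Set.range fun n : ℕ => (A ^ n) g)

/-- The Krylov subspace is invariant under the powers of the operator. -/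
lemma krylov_le_comap_pow {H : Type*} [NormedAddCommGroup H] [InnerProductSpace ℂ H]
    (A : H →L[ℂ] H) (g : H) (n : ℕ) :
    krylov A g ≤ (krylov A g).comap ((A ^ n : H →L[ℂ] H) : H →ₗ[ℂ] H) := by
  refine Submodule.span_le.2 ?_
  rintro _ ⟨m, rfl⟩
  exact Submodule.subset_span ⟨n + m, DFunLike.congr_fun (pow_add A n m) g⟩

/-- The closure of the Krylov subspace is invariant under the powers of the operator. -/
lemma pow_apply_mem_topologicalClosure_krylov {H : Type*} [NormedAddCommGroup H]
    [InnerProductSpace ℂ H] (A : H →L[ℂ] H) (g : H) (n : ℕ) {x : H}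
    (hx : x ∈ (krylov A g).topologicalClosure) :
    (A ^ n) x ∈ (krylov A g).topologicalClosure :=
  map_mem_closure (A ^ n).continuous hx fun _ hy => krylov_le_comap_pow A g n hy

/-- A vector is orthogonal to the Krylov subspace iff it is orthogonal to its generators. -/
lemma mem_orthogonal_krylov_iff {H : Type*} [NormedAddCommGroup H] [InnerProductSpace ℂ H]
    (A : H →L[ℂ] H) (g x : H) :
    x ∈ (krylov A g)ᗮ ↔ ∀ n : ℕ, inner ℂ ((A ^ n) g) x = 0 := by
  refine ⟨fun hx n => hx _ (Submodule.subset_span ⟨n, rfl⟩), fun h u hu => ?_⟩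
  induction hu using Submodule.span_induction with
  | mem u hu => obtain ⟨n, rfl⟩ := hu; exact h n
  | zero => simp
  | add u v _ _ hu hv => rw [inner_add_left, hu, hv, add_zero]
  | smul c u _ hu => rw [inner_smul_left, hu, mul_zero]

/-- A bounded normal operator `A` is `K(A,g)`-reduced if and only if
`A* g` belongs to the closure of `K(A,g)`. -/
theorem normal_krylovReduced_iff_adjoint_apply_mem
    {H : Type*} [NormedAddCommGroup H] [InnerProductSpace ℂ H] [CompleteSpace H]
    (A : H →L[ℂ] H)
    (hA : A ∘L ContinuousLinearMap.adjoint A = ContinuousLinearMap.adjoint A ∘L A)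
    (g : H) :
    (∀ x ∈ (krylov A g)ᗮ, A x ∈ (krylov A g)ᗮ) ↔
      (ContinuousLinearMap.adjoint A) g ∈ (krylov A g).topologicalClosure := by
  constructor
  · intro h
    rw [← Submodule.orthogonal_orthogonal_eq_closure]
    intro x hx
    rw [ContinuousLinearMap.adjoint_inner_right, inner_eq_zero_symm]
    simpa using (mem_orthogonal_krylov_iff A g _).1 (h x hx) 0
  · intro h x hx
    rw [mem_orthogonal_krylov_iff]
    intro n
    have hcomm : Commute (A ^ n) (ContinuousLinearMap.adjoint A) := Commute.pow_left hA n
    have happly : (A ^ n) (ContinuousLinearMap.adjoint A g) =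
        ContinuousLinearMap.adjoint A ((A ^ n) g) := DFunLike.congr_fun hcomm.eq g
    rw [← ContinuousLinearMap.adjoint_inner_left, ← happly]
    rw [← Submodule.orthogonal_closure] at hx
    exact hx _ (pow_apply_mem_topologicalClosure_krylov A g n h)
end

section
/- Let H be a complex Hilbert space, A a bounded self-adjoint operator on H, and g ∈ ran A. Then there exists a solution f to the inverse linear problem A f = g with f belonging to the closure of K(A,g). -/
theorem mem_krylov_self {H : Type*} [NormedAddCommGroup H] [InnerProductSpace ℂ H]
    (A : H →L[ℂ] H) (g : H) : g ∈ krylov A g :=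
  Submodule.subset_span ⟨0, by simp⟩

theorem map_mem_krylov {H : Type*} [NormedAddCommGroup H] [InnerProductSpace ℂ H]
    {A : H →L[ℂ] H} {g x : H} (hx : x ∈ krylov A g) : A x ∈ krylov A g := by
  unfold krylov at hx
  induction hx using Submodule.span_induction with
  | mem x hx =>
    obtain ⟨n, rfl⟩ := hx
    exact Submodule.subset_span ⟨n + 1, by simp [pow_succ']⟩
  | zero => simp
  | add x y _ _ hx hy => simpa using add_mem hx hy
  | smul c x _ hx => simpa using Submodule.smul_mem _ c hx

theorem map_mem_topologicalClosure_krylov {H : Type*} [NormedAddCommGroup H]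
    [InnerProductSpace ℂ H] {A : H →L[ℂ] H} {g x : H}
    (hx : x ∈ (krylov A g).topologicalClosure) : A x ∈ (krylov A g).topologicalClosure :=
  map_mem_closure A.continuous hx fun _ => map_mem_krylov

/-- A bounded self-adjoint inverse problem is always Krylov-solvable: if `A` is bounded
self-adjoint and `g ∈ ran A`, then `A f = g` has a solution `f` in the closure of `K(A,g)`. -/
theorem isSelfAdjoint_krylovSolvable
    {H : Type*} [NormedAddCommGroup H] [InnerProductSpace ℂ H] [CompleteSpace H]
    (A : H →L[ℂ] H) (hA : IsSelfAdjoint A) (g : H) (hg : g ∈ Set.range A) :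
    ∃ f ∈ (krylov A g).topologicalClosure, A f = g := by
  obtain ⟨h, rfl⟩ := hg
  set K := (krylov A (A h)).topologicalClosure
  have : CompleteSpace K := (Submodule.isClosed_topologicalClosure _).completeSpace_coe
  have hinv : ∀ x ∈ K, A x ∈ K := fun x hx => map_mem_topologicalClosure_krylov hx
  have hf : K.starProjection h ∈ K := K.starProjection_apply_mem h
  have hperp : h - K.starProjection h ∈ Kᗮ := K.sub_starProjection_mem_orthogonal h
  have hAK : A (h - K.starProjection h) ∈ K := by
    rw [map_sub]
    exact sub_mem (Submodule.le_topologicalClosure _ (mem_krylov_self A (A h))) (hinv _ hf)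
  have hAperp : A (h - K.starProjection h) ∈ Kᗮ := by
    rw [Submodule.mem_orthogonal]
    intro u hu
    exact (hA.isSymmetric u _).symm.trans (hperp _ (hinv u hu))
  have hzero : A (h - K.starProjection h) = 0 :=
    inner_self_eq_zero.mp (hAperp _ hAK : inner ℂ _ _ = 0)
  exact ⟨_, hf, (sub_eq_zero.mp (by rwa [map_sub] at hzero)).symm⟩
end

section
/- Let H be a complex Hilbert space, A a bounded linear operator on H that is bijective with bounded inverse A⁻¹, and g ∈ H. Then the Krylov intersection I(A,g) is trivial ({0}) if and only if the unique solution f = A⁻¹ g to A f = g belongs to the closure of K(A,g). -/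
/-- The Krylov intersection `I(A,g) := closure(K(A,g)) ∩ A(K(A,g)ᗮ)`. -/
def krylovIntersection {H : Type*} [NormedAddCommGroup H] [InnerProductSpace ℂ H]
    (A : H →L[ℂ] H) (g : H) : Set H :=
  ((krylov A g).topologicalClosure : Set H) ∩ (A '' ((krylov A g)ᗮ : Set H))

section KrylovLemmas

variable {H : Type*} [NormedAddCommGroup H] [InnerProductSpace ℂ H]

theorem self_mem_krylov (A : H →L[ℂ] H) (g : H) : g ∈ krylov A g :=
  Submodule.subset_span ⟨0, by simp⟩

theorem krylov_le_comap (A : H →L[ℂ] H) (g : H) :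
    krylov A g ≤ (krylov A g).comap (A : H →ₗ[ℂ] H) := by
  refine Submodule.span_le.2 ?_
  rintro _ ⟨n, rfl⟩
  exact Submodule.subset_span ⟨n + 1, by simp [pow_succ']⟩

/-- A bounded operator mapping `S` into the closure of `T` maps the closure of `S` there too. -/
theorem apply_mem_topologicalClosure_of_le_comap (T : H →L[ℂ] H) {S U : Submodule ℂ H}
    (h : S ≤ U.topologicalClosure.comap (T : H →ₗ[ℂ] H)) {x : H}
    (hx : x ∈ S.topologicalClosure) : T x ∈ U.topologicalClosure :=
  Submodule.topologicalClosure_minimal S h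
    (U.isClosed_topologicalClosure.preimage T.continuous) hx

theorem apply_mem_topologicalClosure_krylov (A : H →L[ℂ] H) (g : H) {x : H}
    (hx : x ∈ (krylov A g).topologicalClosure) : A x ∈ (krylov A g).topologicalClosure :=
  apply_mem_topologicalClosure_of_le_comap A
    ((krylov_le_comap A g).trans
      (Submodule.comap_mono (krylov A g).le_topologicalClosure)) hx

/-- If `A⁻¹ g` lies in the closure of `K(A,g)`, that closure is invariant under `A⁻¹`. -/
theorem leftInverse_apply_mem_topologicalClosure_krylov {A B : H →L[ℂ] H}
    (hBA : Function.LeftInverse B A) {g : H} (hg : B g ∈ (krylov A g).topologicalClosure) {x : H}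
    (hx : x ∈ (krylov A g).topologicalClosure) : B x ∈ (krylov A g).topologicalClosure := by
  refine apply_mem_topologicalClosure_of_le_comap B (Submodule.span_le.2 ?_) hx
  rintro _ ⟨n, rfl⟩
  cases n with
  | zero => exact hg
  | succ n =>
    have h : B ((A ^ (n + 1)) g) = (A ^ n) g := by
      rw [pow_succ']
      exact hBA _
    change B ((A ^ (n + 1)) g) ∈ (krylov A g).topologicalClosure
    rw [h]
    exact (krylov A g).le_topologicalClosure (Submodule.subset_span ⟨n, rfl⟩)

end KrylovLemmas

/-- For a bounded operator `A` with bounded inverse `B = A⁻¹`, the Krylov intersection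
`I(A,g)` is trivial if and only if the unique solution `f = A⁻¹ g` of `A f = g` belongs to
the closure of `K(A,g)`. -/
theorem krylovIntersection_trivial_iff_inv_apply_mem
    {H : Type*} [NormedAddCommGroup H] [InnerProductSpace ℂ H] [CompleteSpace H]
    (A B : H →L[ℂ] H) (hAB : A ∘L B = 1) (hBA : B ∘L A = 1) (g : H) :
    krylovIntersection A g = {0} ↔ B g ∈ (krylov A g).topologicalClosure := by
  have hA : Function.LeftInverse A B := fun x => DFunLike.congr_fun hAB x
  have hB : Function.LeftInverse B A := fun x => DFunLike.congr_fun hBA x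
  constructor
  · intro h
    obtain ⟨m, hm, w, hw, hmw⟩ :=
      (krylov A g).topologicalClosure.exists_add_mem_mem_orthogonal (B g)
    rw [Submodule.orthogonal_closure] at hw
    have hAw : A w = g - A m := by
      rw [← hA g, hmw, map_add, add_sub_cancel_left]
    have hmem : A w ∈ krylovIntersection A g := by
      refine ⟨?_, w, hw, rfl⟩
      rw [hAw]
      exact sub_mem ((krylov A g).le_topologicalClosure (self_mem_krylov A g))
        (apply_mem_topologicalClosure_krylov A g hm)
    rw [h, Set.mem_singleton_iff] at hmem
    have hw0 : w = 0 := hB.injective (hmem.trans (map_zero A).symm)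
    rwa [hmw, hw0, add_zero]
  · intro hg
    refine Set.Subset.antisymm ?_ ?_
    · rintro _ ⟨hx, w, hw, rfl⟩
      have hw' := leftInverse_apply_mem_topologicalClosure_krylov hB hg hx
      rw [hB w] at hw'
      rw [SetLike.mem_coe, ← Submodule.orthogonal_closure] at hw
      have hw0 : w = 0 := Submodule.disjoint_def.1 (Submodule.orthogonal_disjoint _) w hw' hw
      simp [hw0]
    · rintro _ rfl
      exact ⟨zero_mem _, 0, zero_mem _, map_zero A⟩
end

section
/- Let H be a complex Hilbert space, A a compact normal operator on H, and g ∈ H. Then A is K(A,g)-reduced, i.e., A maps K(A,g)^⊥ into K(A,g)^⊥. -/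
/-- On a set of complex numbers accumulating only at `0`, every function that is continuous and
vanishes at `0` is a uniform limit of polynomials. -/
theorem exists_polynomial_near_of_finite_inter {S : Set ℂ}
    (hS : ∀ δ > 0, (S ∩ {z | δ ≤ ‖z‖}).Finite) {f : ℂ → ℂ} (hf : ContinuousAt f 0)
    (hf0 : f 0 = 0) {ε : ℝ} (hε : 0 < ε) :
    ∃ p : Polynomial ℂ, ∀ z ∈ S, ‖f z - p.eval z‖ ≤ ε := by
  classical
  obtain ⟨δ, hδ, hfδ⟩ := Metric.continuousAt_iff.mp hf (ε / 2) (by positivity)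
  simp only [dist_zero_right, hf0] at hfδ
  set F := (hS (δ / 2) (by positivity)).toFinset with hF
  have hmem : ∀ z, z ∈ F ↔ z ∈ S ∧ δ / 2 ≤ ‖z‖ := fun z ↦ by simp [hF]
  set G := F.filter (fun z ↦ δ ≤ ‖z‖) with hG
  have hGpos : ∀ i ∈ G, δ ≤ ‖i‖ := fun i hi ↦ (Finset.mem_filter.mp hi).2
  have hGF : ∀ i ∈ G, i ∈ F := fun i hi ↦ (Finset.mem_filter.mp hi).1
  have hG0 : ∀ i ∈ G, i ≠ 0 := fun i hi ↦ norm_pos_iff.mp (hδ.trans_le (hGpos i hi))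
  obtain ⟨M, hM⟩ := (isCompact_closedBall (0 : ℂ) (δ / 2)).exists_bound_of_continuousOn
    (f := fun z ↦ ∑ i ∈ G, ‖f i‖ * ‖(Lagrange.basis F id i).eval z‖)
    (Continuous.continuousOn (by fun_prop))
  obtain ⟨N, hN⟩ : ∃ N : ℕ, (1 / 2 : ℝ) ^ N * M < ε / 2 := by
    have h := (tendsto_pow_atTop_nhds_zero_of_lt_one (r := (1 / 2 : ℝ))
      (by norm_num) (by norm_num)).mul_const M
    rw [zero_mul] at h
    exact (h.eventually_lt_const (by positivity)).exists
  refine ⟨∑ i ∈ G, Polynomial.C (f i / i ^ N) * Polynomial.X ^ N * Lagrange.basis F id i,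
    fun z hz ↦ ?_⟩
  simp only [Polynomial.eval_finsetSum, Polynomial.eval_mul, Polynomial.eval_C,
    Polynomial.eval_pow, Polynomial.eval_X]
  have hne : ∀ i, i ≠ z → z ∈ F → (Lagrange.basis F id i).eval z = 0 := fun i hi hzF ↦
    Lagrange.eval_basis_of_ne (v := id) hi hzF
  by_cases hzF : z ∈ F
  · by_cases hzG : z ∈ G
    · rw [Finset.sum_eq_single_of_mem z hzG fun i _ hi ↦ by rw [hne i hi hzF, mul_zero]]
      have h1 : (Lagrange.basis F id z).eval z = 1 :=
        Lagrange.eval_basis_self (v := id) Function.injective_id.injOn hzF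
      rw [h1, mul_one, div_mul_cancel₀ _ (pow_ne_zero _ (hG0 z hzG)), sub_self, norm_zero]
      exact hε.le
    · rw [Finset.sum_eq_zero fun i hi ↦ by
        rw [hne i (fun h ↦ hzG (h ▸ hi)) hzF, mul_zero], sub_zero]
      have hzδ : ‖z‖ < δ := by
        by_contra! h
        exact hzG (Finset.mem_filter.mpr ⟨hzF, h⟩)
      linarith [hfδ hzδ]
  · have hzδ : ‖z‖ < δ / 2 := by
      by_contra! h
      exact hzF ((hmem z).mpr ⟨hz, h⟩)
    have hM' := (le_abs_self _).trans (hM z (by simpa using hzδ.le))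
    have hsum : ‖∑ i ∈ G, f i / i ^ N * z ^ N * (Lagrange.basis F id i).eval z‖
        ≤ (1 / 2 : ℝ) ^ N * M := by
      refine (norm_sum_le _ _).trans (le_trans ?_ (mul_le_mul_of_nonneg_left hM' (by positivity)))
      rw [Finset.mul_sum]
      refine Finset.sum_le_sum fun i hi ↦ ?_
      have hi0 : 0 < ‖i‖ := norm_pos_iff.mpr (hG0 i hi)
      have hratio : ‖z‖ / ‖i‖ ≤ 1 / 2 := by
        rw [div_le_iff₀ hi0]
        linarith [hGpos i hi]
      calc ‖f i / i ^ N * z ^ N * (Lagrange.basis F id i).eval z‖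
          = (‖z‖ / ‖i‖) ^ N * (‖f i‖ * ‖(Lagrange.basis F id i).eval z‖) := by
            simp only [norm_mul, norm_div, norm_pow, div_pow]
            ring
        _ ≤ _ := by gcongr
    calc _ ≤ ‖f z‖ + _ := norm_sub_le _ _
      _ ≤ ε := by linarith [hfδ (show ‖z‖ < δ by linarith)]

section

variable {H : Type*} [NormedAddCommGroup H] [InnerProductSpace ℂ H] [CompleteSpace H]
  {A : H →L[ℂ] H}

theorem IsStarNormal.adjoint_apply_of_apply_eq_smul (hA : IsStarNormal A) {c : ℂ} {x : H}
    (hx : A x = c • x) : ContinuousLinearMap.adjoint A x = star c • x := by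
  have hn : IsStarNormal (A - c • (1 : H →L[ℂ] H)) := by
    refine ⟨?_⟩
    rw [star_sub, star_smul, star_one]
    exact (hA.star_comm_self.sub_right ((Commute.one_right _).smul_right _)).sub_left
      ((Commute.one_left _).smul_left _)
  have h := (ContinuousLinearMap.IsStarNormal.adjoint_apply_eq_zero_iff hn x).mpr (by simp [hx])
  rw [← ContinuousLinearMap.star_eq_adjoint, star_sub, star_smul, star_one] at h
  simpa [sub_eq_zero, ContinuousLinearMap.star_eq_adjoint] using h

theorem IsStarNormal.inner_eq_zero_of_apply_eq_smul (hA : IsStarNormal A) {c d : ℂ} {x y : H}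
    (hx : A x = c • x) (hy : A y = d • y) (hcd : c ≠ d) : inner ℂ x y = 0 := by
  have h := ContinuousLinearMap.adjoint_inner_left A y x
  rw [hA.adjoint_apply_of_apply_eq_smul hx, hy, inner_smul_left, inner_smul_right] at h
  have h' : (c - d) * inner ℂ x y = 0 := by
    simpa [sub_mul, sub_eq_zero] using h
  exact (mul_eq_zero.mp h').resolve_left (sub_ne_zero.mpr hcd)

theorem IsCompactOperator.finite_spectrum_inter_of_isStarNormal (hcpt : IsCompactOperator A)
    (hA : IsStarNormal A) {δ : ℝ} (hδ : 0 < δ) :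
    (spectrum ℂ A ∩ {z | δ ≤ ‖z‖}).Finite := by
  by_contra hinf
  let l := Set.Infinite.natEmbedding _ hinf
  have hlδ : ∀ n, δ ≤ ‖(l n : ℂ)‖ := fun n ↦ (l n).2.2
  have hev : ∀ n, ∃ x : H, ‖x‖ = 1 ∧ A x = (l n : ℂ) • x := fun n ↦ by
    have h := (hcpt.hasEigenvalue_iff_mem_spectrum
      (norm_pos_iff.mp (hδ.trans_le (hlδ n)))).mpr (l n).2.1
    obtain ⟨x, hx⟩ := h.exists_hasEigenvector
    have hx1 : A x = (l n : ℂ) • x := hx.apply_eq_smul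
    refine ⟨((‖x‖⁻¹ : ℝ) : ℂ) • x, ?_, ?_⟩
    · rw [norm_smul, Complex.norm_real, norm_inv, norm_norm,
        inv_mul_cancel₀ (norm_ne_zero_iff.mpr hx.2)]
    · rw [map_smul, hx1, smul_comm]
  choose e he1 he using hev
  have hsep : ∀ m n, m ≠ n → δ ≤ dist (A (e m)) (A (e n)) := fun m n hmn ↦ by
    have hne : (l m : ℂ) ≠ l n := fun h ↦ hmn (l.injective (Subtype.ext h))
    have hinner : inner ℂ (e m) (A (e m) - A (e n)) = (l m : ℂ) := by
      rw [he m, he n, inner_sub_right, inner_smul_right, inner_smul_right,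
        hA.inner_eq_zero_of_apply_eq_smul (he m) (he n) hne, inner_self_eq_norm_sq_to_K, he1]
      simp
    calc δ ≤ ‖(l m : ℂ)‖ := hlδ m
      _ ≤ ‖e m‖ * ‖A (e m) - A (e n)‖ := hinner ▸ norm_inner_le_norm _ _
      _ = dist (A (e m)) (A (e n)) := by rw [he1, one_mul, dist_eq_norm]
  obtain ⟨K, hK, hAK⟩ := IsCompactOperator.image_closedBall_subset_compact
    (f := (A : H →ₗ[ℂ] H)) hcpt 1
  obtain ⟨a, -, φ, hφ, hlim⟩ := hK.tendsto_subseq (x := fun n ↦ A (e n)) fun n ↦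
    hAK ⟨e n, by simp [he1], rfl⟩
  obtain ⟨N, hN⟩ := Metric.cauchySeq_iff'.mp hlim.cauchySeq δ hδ
  exact (hN (N + 1) N.le_succ).not_ge (hsep _ _ (hφ.injective.ne N.succ_ne_self))

/-- The adjoint of a compact normal operator is a norm limit of polynomials in the operator. -/
theorem IsCompactOperator.exists_aeval_near_adjoint (hcpt : IsCompactOperator A)
    (hA : IsStarNormal A) {ε : ℝ} (hε : 0 < ε) :
    ∃ p : Polynomial ℂ, ‖ContinuousLinearMap.adjoint A - Polynomial.aeval A p‖ ≤ ε := by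
  obtain ⟨p, hp⟩ := exists_polynomial_near_of_finite_inter
    (fun δ hδ ↦ hcpt.finite_spectrum_inter_of_isStarNormal hA hδ)
    (f := star) continuous_star.continuousAt (star_zero _) hε
  refine ⟨p, ?_⟩
  rw [← ContinuousLinearMap.star_eq_adjoint, ← cfc_star_id (R := ℂ) A, ← cfc_polynomial p A,
    ← cfc_sub ..]
  exact norm_cfc_le hε.le hp

end

theorem aeval_apply_mem_krylov {H : Type*} [NormedAddCommGroup H] [InnerProductSpace ℂ H]
    (A : H →L[ℂ] H) (g : H) (p : Polynomial ℂ) : Polynomial.aeval A p g ∈ krylov A g := by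
  rw [Polynomial.aeval_eq_sum_range, sum_apply]
  exact Submodule.sum_mem _ fun n _ ↦ Submodule.smul_mem _ _ (Submodule.subset_span ⟨n, rfl⟩)

/-- A compact normal operator `A` on a complex Hilbert space is `K(A,g)`-reduced for
every `g`: it maps `K(A,g)ᗮ` into itself. -/
theorem compact_normal_krylovReduced
    {H : Type*} [NormedAddCommGroup H] [InnerProductSpace ℂ H] [CompleteSpace H]
    (A : H →L[ℂ] H) (hcpt : IsCompactOperator A)
    (hnormal : A ∘L ContinuousLinearMap.adjoint A = ContinuousLinearMap.adjoint A ∘L A)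
    (g : H) :
    ∀ x ∈ (krylov A g)ᗮ, A x ∈ (krylov A g)ᗮ := by
  intro x hx
  have hA : IsStarNormal A := ⟨hnormal.symm⟩
  refine (Submodule.mem_orthogonal _ _).mpr fun u hu ↦ ?_
  induction hu using Submodule.span_induction with
  | zero => exact inner_zero_left _
  | add u v _ _ hu hv => rw [inner_add_left, hu, hv, add_zero]
  | smul c u _ hu => rw [inner_smul_left, hu, mul_zero]
  | mem u hu =>
    obtain ⟨n, rfl⟩ := hu
    set v := (A ^ n) g
    have hbound : ∀ ε > 0, ‖inner ℂ v (A x)‖ ≤ ε * (‖v‖ * ‖x‖) := fun ε hε ↦ by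
      obtain ⟨p, hp⟩ := hcpt.exists_aeval_near_adjoint hA hε
      have hmem : Polynomial.aeval A p v ∈ krylov A g := by
        have h := aeval_apply_mem_krylov A g (p * Polynomial.X ^ n)
        rwa [map_mul, map_pow, Polynomial.aeval_X] at h
      have heq : inner ℂ v (A x)
          = inner ℂ ((ContinuousLinearMap.adjoint A - Polynomial.aeval A p) v) x := by
        rw [sub_apply, inner_sub_left,
          (Submodule.mem_orthogonal _ _).mp hx _ hmem, sub_zero,
          ContinuousLinearMap.adjoint_inner_left]
      rw [heq, ← mul_assoc]
      refine (norm_inner_le_norm _ _).trans ?_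
      gcongr
      exact ContinuousLinearMap.le_of_opNorm_le _ hp v
    refine norm_le_zero_iff.mp (le_of_forall_pos_le_add fun ε hε ↦ ?_)
    have hpos : 0 < ‖v‖ * ‖x‖ + 1 := by positivity
    calc ‖inner ℂ v (A x)‖ ≤ ε / (‖v‖ * ‖x‖ + 1) * (‖v‖ * ‖x‖) := hbound _ (by positivity)
      _ ≤ ε / (‖v‖ * ‖x‖ + 1) * (‖v‖ * ‖x‖ + 1) := by gcongr; linarith
      _ = 0 + ε := by rw [div_mul_cancel₀ _ hpos.ne', zero_add]
end

section
/- Let H be a complex Hilbert space, A a compact normal operator on H, and g ∈ ran A. Then the inverse problem A f = g has a unique Krylov solution f° (i.e., a unique solution belonging to the closure of K(A,g)), and f° is a minimal norm solution: ‖f°‖ ≤ ‖f‖ for every f ∈ H with A f = g. -/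
open Filter Topology ContinuousLinearMap

/-- A nonzero compact normal operator has an eigenvalue whose modulus is the operator norm. -/
theorem IsCompactOperator.exists_hasEigenvalue_norm_eq
    {H : Type*} [NormedAddCommGroup H] [InnerProductSpace ℂ H] [CompleteSpace H]
    {T : H →L[ℂ] H} (hT : IsCompactOperator T) [IsStarNormal T] (hT₀ : T ≠ 0) :
    ∃ μ : ℂ, ‖μ‖ = ‖T‖ ∧ Module.End.HasEigenvalue (T : Module.End ℂ H) μ := by
  have : Nontrivial H := by
    by_contra h
    rw [not_nontrivial_iff_subsingleton] at h
    exact hT₀ (Subsingleton.elim _ _)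
  obtain ⟨μ, hμ, hμT⟩ := spectrum.exists_nnnorm_eq_spectralRadius T
  rw [IsStarNormal.spectralRadius_eq_nnnorm] at hμT
  have hnorm : ‖μ‖ = ‖T‖ := by
    have : ‖μ‖₊ = ‖T‖₊ := by exact_mod_cast hμT
    exact congrArg NNReal.toReal this
  have hμ₀ : μ ≠ 0 := by
    rw [← norm_ne_zero_iff, hnorm]
    exact norm_ne_zero_iff.2 hT₀
  exact ⟨μ, hnorm, (hT.hasEigenvalue_iff_mem_spectrum hμ₀).2 hμ⟩

/-- If all the moments `⟪u, Tⁿ u⟫` with `n ≥ 1` vanish, then `u` is orthogonal to every eigenspace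
of `T` whose eigenvalue has modulus `‖T‖`. This follows from the mean ergodic theorem. -/
theorem ContinuousLinearMap.inner_eq_zero_of_forall_inner_pow_eq_zero
    {H : Type*} [NormedAddCommGroup H] [InnerProductSpace ℂ H] [CompleteSpace H]
    {T : H →L[ℂ] H} {μ : ℂ} (hμ₀ : μ ≠ 0) (hμ : ‖μ‖ = ‖T‖) {u v : H}
    (hu : ∀ n : ℕ, inner ℂ u ((T ^ (n + 1)) u) = 0) (hv : T v = μ • v) :
    inner ℂ u v = 0 := by
  set f : H →L[ℂ] H := μ⁻¹ • T with hf
  have hfnorm : ‖f‖ ≤ 1 := by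
    rw [hf, norm_smul, norm_inv, hμ, inv_mul_cancel₀]
    rw [← hμ]
    exact norm_ne_zero_iff.2 hμ₀
  let E := f.eqLocus (1 : H →L[ℂ] H)
  have hlim := f.tendsto_birkhoffAverage_orthogonalProjection hfnorm u
  have hlim_inner := (tendsto_const_nhds (x := u)).inner (𝕜 := ℂ) hlim
  have hfu : ∀ n : ℕ, inner ℂ u (f^[n + 1] u) = 0 := fun n => by
    rw [← FunLike.coe_pow_eq_iterate, hf, smul_pow, smul_apply,
      inner_smul_right, hu, mul_zero]
  have hsum : ∀ n : ℕ, inner ℂ u (birkhoffAverage ℂ f _root_.id (n + 1) u)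
      = ((n + 1 : ℕ) : ℂ)⁻¹ * inner ℂ u u := fun n => by
    rw [birkhoffAverage, birkhoffSum, inner_smul_right, inner_sum, Finset.sum_range_succ']
    simp [hfu, -Function.iterate_succ]
  have hzero : Tendsto (fun n : ℕ => inner ℂ u (birkhoffAverage ℂ f _root_.id (n + 1) u))
      atTop (𝓝 0) := by
    simp_rw [hsum]
    have := ((tendsto_inv_atTop_nhds_zero_nat (𝕜 := ℂ)).comp (tendsto_add_atTop_nat 1)).mul_const
      (inner ℂ u u)
    simpa using this
  have hproj : inner ℂ u (E.starProjection u) = 0 :=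
    tendsto_nhds_unique (hlim_inner.comp (tendsto_add_atTop_nat 1)) hzero
  have hproj₀ : E.starProjection u = 0 := by
    rw [← inner_self_eq_zero (𝕜 := ℂ), Submodule.inner_starProjection_left_eq_right,
      Submodule.starProjection_eq_self_iff.2 (E.starProjection_apply_mem u), hproj]
  have hvE : v ∈ E := by
    change f v = v
    rw [hf, smul_apply, hv, inv_smul_smul₀ hμ₀]
  rw [← Submodule.starProjection_eq_self_iff.2 hvE,
    ← Submodule.inner_starProjection_left_eq_right, hproj₀, inner_zero_left]

/-- The restriction of a normal operator to a closed reducing subspace is normal. -/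
theorem ContinuousLinearMap.isStarNormal_restrict
    {H : Type*} [NormedAddCommGroup H] [InnerProductSpace ℂ H] [CompleteSpace H]
    {A : H →L[ℂ] H} [hA : IsStarNormal A] {V : Submodule ℂ H} [CompleteSpace V]
    (hV : ∀ x ∈ V, A x ∈ V) (hV' : ∀ x ∈ V, adjoint A x ∈ V) :
    IsStarNormal (A.restrict hV) := by
  have hadj : adjoint (A.restrict hV) = (adjoint A).restrict hV' := by
    symm
    rw [ContinuousLinearMap.eq_adjoint_iff]
    intro x y
    exact adjoint_inner_left A (y : H) (x : H)
  rw [isStarNormal_iff_norm_eq_adjoint, hadj]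
  intro x
  exact isStarNormal_iff_norm_eq_adjoint.1 hA x

/-- If `A` is compact and normal and all the moments `⟪u, Aⁿ u⟫` with `n ≥ 1` vanish,
then `A u = 0`. -/
theorem IsCompactOperator.apply_eq_zero_of_forall_inner_pow_eq_zero
    {H : Type*} [NormedAddCommGroup H] [InnerProductSpace ℂ H] [CompleteSpace H]
    {A : H →L[ℂ] H} (hA : IsCompactOperator A) [IsStarNormal A] {u : H}
    (hu : ∀ n : ℕ, inner ℂ u ((A ^ (n + 1)) u) = 0) : A u = 0 := by
  let C := StarSubalgebra.centralizer ℂ {A}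
  have hAC : A ∈ C := by
    simp [C, StarSubalgebra.mem_centralizer_iff, star_comm_self' A]
  let W : Submodule ℂ H := Submodule.span ℂ {x | ∃ S ∈ C, S u = x}
  let V : Submodule ℂ H := W.topologicalClosure
  have hWC : ∀ S ∈ C, W ≤ W.comap (S : H →ₗ[ℂ] H) := fun S hS => by
    refine Submodule.span_le.2 ?_
    rintro _ ⟨R, hR, rfl⟩
    exact Submodule.subset_span ⟨S * R, mul_mem hS hR, rfl⟩
  have hVC : ∀ S ∈ C, ∀ x ∈ V, S x ∈ V := fun S hS x hx =>
    map_mem_closure S.continuous hx fun y hy => hWC S hS hy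
  have huV : u ∈ V := W.le_topologicalClosure (Submodule.subset_span ⟨1, one_mem C, rfl⟩)
  have : CompleteSpace V := W.isClosed_topologicalClosure.completeSpace_coe
  let B : V →L[ℂ] V := A.restrict (hVC A hAC)
  have : IsStarNormal B := isStarNormal_restrict (hVC A hAC) (hVC _ (star_mem hAC))
  have hB : IsCompactOperator B := hA.restrict' (f := (A : H →ₗ[ℂ] H)) (hVC A hAC)
  have hBpow : ∀ (n : ℕ) (x : V), (((B ^ n) x : V) : H) = (A ^ n) x := fun n => by
    induction n with
    | zero => intro x; rfl
    | succ n ih => intro x; rw [pow_succ, pow_succ]; exact ih (B x)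
  suffices B = 0 from
    congrArg Subtype.val (DFunLike.congr_fun this (⟨u, huV⟩ : V))
  by_contra hB₀
  obtain ⟨μ, hμ, hμB⟩ := hB.exists_hasEigenvalue_norm_eq hB₀
  have hμ₀ : μ ≠ 0 := by
    rw [← norm_ne_zero_iff, hμ]
    exact norm_ne_zero_iff.2 hB₀
  obtain ⟨v, hv⟩ := hμB.exists_hasEigenvector
  have hAv : A v = μ • (v : H) := congrArg Subtype.val hv.apply_eq_smul
  have hSv : ∀ S ∈ C, inner ℂ (S u) (v : H) = 0 := fun S hS => by
    rw [← adjoint_inner_right]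
    have hS' : star S ∈ C := star_mem hS
    refine inner_eq_zero_of_forall_inner_pow_eq_zero (T := B) (u := ⟨u, huV⟩)
      (v := ⟨star S v, hVC _ hS' v v.2⟩) hμ₀ hμ (fun n => ?_) (Subtype.ext ?_)
    · rw [Submodule.coe_inner, hBpow]
      exact hu n
    · have hcomm : A * star S = star S * A :=
        ((StarSubalgebra.mem_centralizer_iff ℂ).1 hS' A rfl).1
      change (A * star S) v = μ • star S v
      rw [hcomm, ← map_smul, ← hAv]
      rfl
  have hvW : (v : H) ∈ Wᗮ := by
    refine (Submodule.mem_orthogonal W _).2 fun x hx => ?_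
    induction hx using Submodule.span_induction with
    | mem x hx => obtain ⟨S, hS, rfl⟩ := hx; exact hSv S hS
    | zero => exact inner_zero_left _
    | add x y _ _ hx hy => rw [inner_add_left, hx, hy, add_zero]
    | smul a x _ hx => rw [inner_smul_left, hx, mul_zero]
  rw [← Submodule.orthogonal_closure] at hvW
  exact hv.2 (Subtype.ext (inner_self_eq_zero.1 (hvW v v.2)))

/-- The closed Krylov subspace `closure K(A,g)` is invariant under `A`. -/
theorem apply_mem_krylov_topologicalClosure
    {H : Type*} [NormedAddCommGroup H] [InnerProductSpace ℂ H]
    (A : H →L[ℂ] H) (g : H) {x : H} (hx : x ∈ (krylov A g).topologicalClosure) :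
    A x ∈ (krylov A g).topologicalClosure := by
  have hle : krylov A g ≤ (krylov A g).comap (A : H →ₗ[ℂ] H) := by
    refine Submodule.span_le.2 ?_
    rintro _ ⟨n, rfl⟩
    exact Submodule.subset_span ⟨n + 1, by simp only [pow_succ']; rfl⟩
  exact map_mem_closure A.continuous hx fun y hy => hle hy

/-- If the right-hand side lies in the range of `A`, so does its Krylov subspace. -/
theorem krylov_apply_le_range
    {H : Type*} [NormedAddCommGroup H] [InnerProductSpace ℂ H]
    (A : H →L[ℂ] H) (f : H) : krylov A (A f) ≤ A.range := by
  refine Submodule.span_le.2 ?_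
  rintro _ ⟨n, rfl⟩
  refine ⟨(A ^ n) f, ?_⟩
  change (A * A ^ n) f = (A ^ n * A) f
  rw [← pow_succ, ← pow_succ']


/-- For a compact normal operator `A` and `g ∈ ran A`, the inverse problem `A f = g` admits
a unique Krylov solution `f₀` (a unique solution in the closure of `K(A,g)`), and `f₀` is a
minimal-norm solution. -/
theorem compact_normal_unique_krylov_solution_min_norm
    {H : Type*} [NormedAddCommGroup H] [InnerProductSpace ℂ H] [CompleteSpace H]
    (A : H →L[ℂ] H) (hcpt : IsCompactOperator A)
    (hnormal : A ∘L ContinuousLinearMap.adjoint A = ContinuousLinearMap.adjoint A ∘L A)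
    (g : H) (hg : g ∈ Set.range A) :
    ∃ f₀ : H, (f₀ ∈ (krylov A g).topologicalClosure ∧ A f₀ = g) ∧
      (∀ f : H, f ∈ (krylov A g).topologicalClosure ∧ A f = g → f = f₀) ∧
      (∀ f : H, A f = g → ‖f₀‖ ≤ ‖f‖) := by
  have : IsStarNormal A := ⟨hnormal.symm⟩
  set K := (krylov A g).topologicalClosure
  have : CompleteSpace K := (krylov A g).isClosed_topologicalClosure.completeSpace_coe
  have hKA : ∀ n : ℕ, ∀ x ∈ K, (A ^ n) x ∈ K := fun n => by
    induction n with
    | zero => exact fun x hx => hx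
    | succ n ih =>
      intro x hx
      rw [pow_succ]
      exact ih _ (apply_mem_krylov_topologicalClosure A g hx)
  have hgK : g ∈ K := (krylov A g).le_topologicalClosure (Submodule.subset_span ⟨0, rfl⟩)
  have hproj : ∀ f, A f = g → A (K.starProjection f) = g := fun f hf => by
    have hperp := K.sub_starProjection_mem_orthogonal f
    have hAu : A (f - K.starProjection f) ∈ K := by
      rw [map_sub, hf]
      exact sub_mem hgK (hKA 1 _ (K.starProjection_apply_mem f))
    have hzero : A (f - K.starProjection f) = 0 :=
      hcpt.apply_eq_zero_of_forall_inner_pow_eq_zero fun n => by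
        rw [pow_succ]
        exact Submodule.inner_left_of_mem_orthogonal (hKA n _ hAu) hperp
    rw [map_sub, hf, sub_eq_zero] at hzero
    exact hzero.symm
  have huniq : ∀ f f' : H, f ∈ K → f' ∈ K → A f = g → A f' = g → f = f' := by
    intro f f' hf hf' hAf hAf'
    have hker : f - f' ∈ A.rangeᗮ := by
      rw [ContinuousLinearMap.IsStarNormal.orthogonal_range inferInstance]
      change A (f - f') = 0
      rw [map_sub, hAf, hAf', sub_self]
    rw [← Submodule.orthogonal_closure] at hker
    have hmem : f - f' ∈ A.range.topologicalClosure := by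
      refine Submodule.topologicalClosure_mono ?_ (sub_mem hf hf')
      exact hAf ▸ krylov_apply_le_range A f
    exact sub_eq_zero.1 (inner_self_eq_zero.1 (hker _ hmem))
  obtain ⟨f, hf⟩ := hg
  refine ⟨K.starProjection f, ⟨K.starProjection_apply_mem f, hproj f hf⟩,
    fun f' hf' => huniq _ _ hf'.1 (K.starProjection_apply_mem f) hf'.2 (hproj f hf),
    fun f' hf' => ?_⟩
  rw [huniq _ _ (K.starProjection_apply_mem f) (K.starProjection_apply_mem f') (hproj f hf)
    (hproj f' hf')]
  exact K.norm_starProjection_apply_le f'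
end

section
/- Let A be a (possibly unbounded) densely defined operator on a complex Hilbert space H that is self-adjoint (A* = A) or skew-adjoint (A* = -A), and let g ∈ ran A be a quasi-analytic vector for A, i.e., g ∈ dom(A^n) for every n ∈ ℕ and the series ∑_{n≥1} ‖A^n g‖^{-1/n} diverges to +∞. Then there exists a unique Krylov solution to the inverse linear problem A f = g, i.e., a unique f in the closure of K(A,g) with f ∈ dom A and A f = g. -/
open scoped InnerProductSpace
open Finset InnerProductSpace

/-- **Carleman's inequality**, with constant `2e`. -/
theorem sum_geom_mean_le (a : ℕ → ℝ) (ha : ∀ n, 0 ≤ a n) (N : ℕ) :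
    ∑ n ∈ range N, (∏ k ∈ range (n + 1), a k) ^ ((n : ℝ) + 1)⁻¹ ≤
      2 * Real.exp 1 * ∑ n ∈ range N, a n := by
  set t : ℕ → ℝ := fun n => ∑ k ∈ range n, ((k : ℝ) + 1) * a k with ht
  have t_nonneg (n : ℕ) : 0 ≤ t n :=
    sum_nonneg fun k _ => mul_nonneg (by positivity) (ha k)
  have telescope (n : ℕ) : ∑ k ∈ range n, t (k + 1) / (((k : ℝ) + 1) * (k + 2)) =
      ∑ k ∈ range n, a k - t n / ((n : ℝ) + 1) := by
    induction n with
    | zero => simp [ht]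
    | succ n ih =>
      have : t (n + 1) = t n + ((n : ℝ) + 1) * a n := by simp [ht, sum_range_succ]
      rw [sum_range_succ, sum_range_succ, ih, this]
      push_cast
      field_simp
      ring
  have term_le (n : ℕ) : (∏ k ∈ range (n + 1), a k) ^ ((n : ℝ) + 1)⁻¹ ≤
      2 * Real.exp 1 * (t (n + 1) / (((n : ℝ) + 1) * (n + 2))) := by
    have hn : (0 : ℝ) < (n : ℝ) + 1 := by positivity
    have amgm := Real.geom_mean_le_arith_mean (range (n + 1)) (fun _ => 1)
      (fun k => ((k : ℝ) + 1) * a k) (by simp) (by simpa using hn)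
      (fun k _ => mul_nonneg (by positivity) (ha k))
    simp only [Real.rpow_one, sum_const, card_range, one_mul, nsmul_eq_mul, mul_one,
      prod_mul_distrib] at amgm
    push_cast at amgm
    have hfac : ∏ k ∈ range (n + 1), ((k : ℝ) + 1) = ((n + 1).factorial : ℝ) := by
      rw [← prod_range_add_one_eq_factorial]
      push_cast
      rfl
    have hprod : 0 ≤ ∏ k ∈ range (n + 1), a k := prod_nonneg fun k _ => ha k
    rw [hfac, Real.mul_rpow (by positivity) hprod] at amgm
    have hfac_ge : ((n : ℝ) + 1) / Real.exp 1 ≤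
        ((n + 1).factorial : ℝ) ^ ((n : ℝ) + 1)⁻¹ := by
      have h := Real.pow_div_factorial_le_exp ((n : ℝ) + 1) hn.le (n + 1)
      rw [div_le_iff₀ (by positivity)] at h
      have hexp : Real.exp ((n : ℝ) + 1) = Real.exp 1 ^ (n + 1) := by
        rw [← Real.exp_nat_mul]
        push_cast
        rw [mul_one]
      have h2 : (((n : ℝ) + 1) / Real.exp 1) ^ (n + 1) ≤ ((n + 1).factorial : ℝ) := by
        rw [div_pow, div_le_iff₀ (by positivity), ← hexp]
        linarith
      have h3 := Real.rpow_le_rpow (by positivity) h2 (inv_pos.2 hn).le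
      have h4 := Real.pow_rpow_inv_natCast
        (show (0 : ℝ) ≤ ((n : ℝ) + 1) / Real.exp 1 by positivity) (Nat.succ_ne_zero n)
      push_cast at h4
      rwa [h4] at h3
    have hG : 0 ≤ (∏ k ∈ range (n + 1), a k) ^ ((n : ℝ) + 1)⁻¹ := Real.rpow_nonneg hprod _
    have h1 := (mul_le_mul_of_nonneg_right hfac_ge hG).trans amgm
    have h2 : (∏ k ∈ range (n + 1), a k) ^ ((n : ℝ) + 1)⁻¹ ≤
        Real.exp 1 * (t (n + 1) / (((n : ℝ) + 1) * (n + 1))) := by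
      rw [div_mul_eq_mul_div, div_le_div_iff₀ (Real.exp_pos 1) hn] at h1
      rw [← mul_div_assoc, le_div_iff₀ (by positivity)]
      calc _ = ((n : ℝ) + 1) * (∏ k ∈ range (n + 1), a k) ^ ((n : ℝ) + 1)⁻¹ * (n + 1) := by ring
        _ ≤ _ := h1
        _ = _ := by ring
    have h3 : t (n + 1) / (((n : ℝ) + 1) * (n + 1)) ≤
        2 * (t (n + 1) / (((n : ℝ) + 1) * (n + 2))) := by
      rw [← mul_div_assoc, div_le_div_iff₀ (by positivity) (by positivity)]
      have := mul_nonneg (t_nonneg (n + 1)) (mul_nonneg hn.le (Nat.cast_nonneg (α := ℝ) n))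
      nlinarith
    calc _ ≤ _ := h2
      _ ≤ Real.exp 1 * (2 * (t (n + 1) / (((n : ℝ) + 1) * (n + 2)))) := by gcongr
      _ = _ := by ring
  calc _ ≤ ∑ n ∈ range N, 2 * Real.exp 1 * (t (n + 1) / (((n : ℝ) + 1) * (n + 2))) :=
        sum_le_sum fun n _ => term_le n
    _ = 2 * Real.exp 1 * (∑ n ∈ range N, a n - t N / ((N : ℝ) + 1)) := by
        rw [← mul_sum, telescope]
    _ ≤ _ := by
        have : 0 ≤ t N / ((N : ℝ) + 1) := div_nonneg (t_nonneg N) (by positivity)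
        gcongr
        linarith

/-- If `w (n + 1)` dominates a multiple of `b 0 * ⋯ * b n`, then the partial sums of
`∑ w n ^ (-1 / n)` are controlled by those of `∑ (b n)⁻¹`. -/
theorem sum_rpow_neg_inv_le {b w : ℕ → ℝ} (hb : ∀ n, 0 < b n) {C : ℝ} (hC : 0 < C)
    (hw : ∀ n, C * ∏ k ∈ range n, b k ≤ w n) (N : ℕ) :
    ∑ n ∈ range N, w (n + 1) ^ (-(1 : ℝ) / ((n : ℝ) + 1)) ≤
      max 1 C⁻¹ * (2 * Real.exp 1 * ∑ n ∈ range N, (b n)⁻¹) := by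
  have hmax : 0 ≤ max 1 C⁻¹ := zero_le_one.trans (le_max_left _ _)
  refine le_trans ?_ (mul_le_mul_of_nonneg_left
    (sum_geom_mean_le (fun n => (b n)⁻¹) (fun n => (inv_pos.2 (hb n)).le) N) hmax)
  rw [mul_sum]
  refine sum_le_sum fun n _ => ?_
  have hprod : 0 < ∏ k ∈ range (n + 1), b k := prod_pos fun k _ => hb k
  have hexp : (0 : ℝ) ≤ ((n : ℝ) + 1)⁻¹ := by positivity
  rw [neg_div, one_div, prod_inv_distrib]
  calc w (n + 1) ^ (-((n : ℝ) + 1)⁻¹)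
      ≤ (C * ∏ k ∈ range (n + 1), b k) ^ (-((n : ℝ) + 1)⁻¹) :=
        Real.rpow_le_rpow_of_nonpos (mul_pos hC hprod) (hw (n + 1)) (by linarith)
    _ = C⁻¹ ^ ((n : ℝ) + 1)⁻¹ * (∏ k ∈ range (n + 1), b k)⁻¹ ^ ((n : ℝ) + 1)⁻¹ := by
        rw [Real.mul_rpow hC.le hprod.le, Real.inv_rpow hC.le, Real.inv_rpow hprod.le,
          Real.rpow_neg hC.le, Real.rpow_neg hprod.le]
    _ ≤ _ := by
        refine mul_le_mul_of_nonneg_right ?_ (Real.rpow_nonneg (inv_pos.2 hprod).le _)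
        calc C⁻¹ ^ ((n : ℝ) + 1)⁻¹ ≤ (max 1 C⁻¹) ^ ((n : ℝ) + 1)⁻¹ :=
              Real.rpow_le_rpow (inv_pos.2 hC).le (le_max_right _ _) hexp
          _ ≤ (max 1 C⁻¹) ^ (1 : ℝ) :=
              Real.rpow_le_rpow_of_exponent_le (le_max_left _ _)
                (inv_le_one_of_one_le₀ (by linarith [Nat.cast_nonneg (α := ℝ) n]))
          _ = _ := Real.rpow_one _

section GramSchmidt

variable {E : Type*} [NormedAddCommGroup E] [InnerProductSpace ℂ E] (v : ℕ → E)

theorem inner_gramSchmidtNormed_of_ne {i j : ℕ} (h : i ≠ j) :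
    ⟪gramSchmidtNormed ℂ v i, gramSchmidtNormed ℂ v j⟫_ℂ = 0 := by
  simp [gramSchmidtNormed, gramSchmidt_orthogonal ℂ v h]

theorem inner_self_smul_gramSchmidtNormed (i : ℕ) :
    ⟪gramSchmidtNormed ℂ v i, gramSchmidtNormed ℂ v i⟫_ℂ • gramSchmidtNormed ℂ v i =
      gramSchmidtNormed ℂ v i := by
  by_cases h : gramSchmidtNormed ℂ v i = 0
  · simp [h]
  · rw [inner_self_eq_norm_sq_to_K, gramSchmidtNormed_unit_length' h]
    simp

theorem norm_gramSchmidtNormed_le_one (i : ℕ) : ‖gramSchmidtNormed ℂ v i‖ ≤ 1 := by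
  by_cases h : gramSchmidtNormed ℂ v i = 0
  · simp [h]
  · exact (gramSchmidtNormed_unit_length' h).le

theorem span_gramSchmidtNormed_Iio (n : ℕ) :
    Submodule.span ℂ (gramSchmidtNormed ℂ v '' Set.Iio n) =
      Submodule.span ℂ (v '' Set.Iio n) := by
  rw [span_gramSchmidtNormed, span_gramSchmidt_Iio]

theorem gramSchmidtNormed_mem_span_Iio {k n : ℕ} (h : k < n) :
    gramSchmidtNormed ℂ v k ∈ Submodule.span ℂ (v '' Set.Iio n) := by
  rw [← span_gramSchmidtNormed_Iio]
  exact Submodule.subset_span ⟨k, h, rfl⟩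

theorem sum_inner_smul_gramSchmidtNormed_mem (h : E) (n : ℕ) :
    ∑ k ∈ range n, ⟪gramSchmidtNormed ℂ v k, h⟫_ℂ • gramSchmidtNormed ℂ v k ∈
      Submodule.span ℂ (v '' Set.Iio n) :=
  Submodule.sum_mem _ fun _ hk =>
    Submodule.smul_mem _ _ (gramSchmidtNormed_mem_span_Iio v (mem_range.1 hk))

theorem sum_inner_smul_gramSchmidtNormed {n : ℕ} {x : E}
    (hx : x ∈ Submodule.span ℂ (v '' Set.Iio n)) :
    ∑ k ∈ range n, ⟪gramSchmidtNormed ℂ v k, x⟫_ℂ • gramSchmidtNormed ℂ v k = x := by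
  rw [← span_gramSchmidtNormed_Iio] at hx
  induction hx using Submodule.span_induction with
  | mem x hx =>
    obtain ⟨j, hj, rfl⟩ := hx
    rw [sum_eq_single_of_mem j (mem_range.2 hj)
      fun k _ hk => by rw [inner_gramSchmidtNormed_of_ne v hk, zero_smul]]
    exact inner_self_smul_gramSchmidtNormed v j
  | zero => simp
  | add x y _ _ hx hy => simp only [inner_add_right, add_smul, sum_add_distrib, hx, hy]
  | smul c x _ hx => simp only [inner_smul_right, mul_smul, ← smul_sum, hx]

theorem inner_gramSchmidtNormed_eq_zero {n : ℕ} {x : E}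
    (hx : x ∈ Submodule.span ℂ (v '' Set.Iio n)) :
    ⟪gramSchmidtNormed ℂ v n, x⟫_ℂ = 0 := by
  rw [← sum_inner_smul_gramSchmidtNormed v hx, inner_sum]
  refine sum_eq_zero fun k hk => ?_
  rw [inner_smul_right, inner_gramSchmidtNormed_of_ne v (mem_range.1 hk).ne', mul_zero]

theorem inner_sum_inner_smul_gramSchmidtNormed (h : E) (n : ℕ) :
    ⟪h, ∑ k ∈ range n, ⟪gramSchmidtNormed ℂ v k, h⟫_ℂ • gramSchmidtNormed ℂ v k⟫_ℂ =
      ((∑ k ∈ range n, ‖⟪gramSchmidtNormed ℂ v k, h⟫_ℂ‖ ^ 2 : ℝ) : ℂ) := by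
  rw [inner_sum, Complex.ofReal_sum]
  refine sum_congr rfl fun k _ => ?_
  rw [inner_smul_right, ← inner_conj_symm h, RCLike.mul_conj]
  simp

theorem sum_norm_inner_gramSchmidtNormed_sq_le (h : E) (n : ℕ) :
    ∑ k ∈ range n, ‖⟪gramSchmidtNormed ℂ v k, h⟫_ℂ‖ ^ 2 ≤ ‖h‖ ^ 2 := by
  classical
  have := (gramSchmidtNormed_orthonormal' (𝕜 := ℂ) v).sum_inner_products_le h
    (s := (range n).subtype (fun i => gramSchmidtNormed ℂ v i ≠ 0))
  refine le_trans (le_of_eq ?_) this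
  rw [sum_subtype_eq_sum_filter fun k => ‖⟪gramSchmidtNormed ℂ v k, h⟫_ℂ‖ ^ 2]
  refine (sum_filter_of_ne fun k _ hk => ?_).symm
  contrapose! hk
  simp [hk]

end GramSchmidt

section Jacobi

variable {E : Type*} [NormedAddCommGroup E] [InnerProductSpace ℂ E] {T : E →ₗ[ℂ] E} {v : ℕ → E}

theorem map_mem_span_Iio_succ (hTv : ∀ n, T (v n) = v (n + 1)) {n : ℕ} {x : E}
    (hx : x ∈ Submodule.span ℂ (v '' Set.Iio n)) :
    T x ∈ Submodule.span ℂ (v '' Set.Iio (n + 1)) := by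
  suffices h : Submodule.span ℂ (v '' Set.Iio n) ≤
      (Submodule.span ℂ (v '' Set.Iio (n + 1))).comap T from h hx
  rw [Submodule.span_le]
  rintro _ ⟨k, hk, rfl⟩
  exact Submodule.subset_span ⟨k + 1, Nat.succ_lt_succ hk, (hTv k).symm⟩

theorem inner_gramSchmidtNormed_succ_map (hTv : ∀ n, T (v n) = v (n + 1)) {n : ℕ} {x : E}
    (hx : x ∈ Submodule.span ℂ (v '' Set.Iio (n + 1))) :
    ⟪gramSchmidtNormed ℂ v (n + 1), T x⟫_ℂ = ⟪gramSchmidtNormed ℂ v n, x⟫_ℂ *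
      ⟪gramSchmidtNormed ℂ v (n + 1), T (gramSchmidtNormed ℂ v n)⟫_ℂ := by
  conv_lhs => rw [← sum_inner_smul_gramSchmidtNormed v hx, sum_range_succ]
  rw [map_add, inner_add_right, map_smul, inner_smul_right,
    inner_gramSchmidtNormed_eq_zero v
      (map_mem_span_Iio_succ hTv (sum_inner_smul_gramSchmidtNormed_mem v x n)), zero_add]

theorem norm_inner_gramSchmidtNormed_orbit (hTv : ∀ n, T (v n) = v (n + 1)) (n : ℕ) :
    ‖⟪gramSchmidtNormed ℂ v n, v n⟫_ℂ‖ = ‖⟪gramSchmidtNormed ℂ v 0, v 0⟫_ℂ‖ *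
      ∏ k ∈ range n,
        ‖⟪gramSchmidtNormed ℂ v (k + 1), T (gramSchmidtNormed ℂ v k)⟫_ℂ‖ := by
  induction n with
  | zero => simp
  | succ n ih =>
    rw [prod_range_succ, ← mul_assoc, ← ih, ← norm_mul, ← hTv n,
      inner_gramSchmidtNormed_succ_map hTv
        (Submodule.subset_span ⟨n, Nat.lt_succ_self n, rfl⟩)]

theorem abs_im_mul_sum_le (hTv : ∀ n, T (v n) = v (n + 1))
    (hsymm : ∀ x ∈ Submodule.span ℂ (Set.range v), ∀ y ∈ Submodule.span ℂ (Set.range v),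
      ⟪T x, y⟫_ℂ = ⟪x, T y⟫_ℂ)
    {z : ℂ} {h : E} (hh : ∀ x ∈ Submodule.span ℂ (Set.range v), ⟪h, T x⟫_ℂ = z * ⟪h, x⟫_ℂ)
    (n : ℕ) :
    |z.im| * ∑ k ∈ range (n + 1), ‖⟪gramSchmidtNormed ℂ v k, h⟫_ℂ‖ ^ 2 ≤
      ‖⟪gramSchmidtNormed ℂ v n, h⟫_ℂ‖ * ‖⟪gramSchmidtNormed ℂ v (n + 1), h⟫_ℂ‖ *
        ‖⟪gramSchmidtNormed ℂ v (n + 1), T (gramSchmidtNormed ℂ v n)⟫_ℂ‖ := by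
  set e := gramSchmidtNormed ℂ v with he
  set p := ∑ k ∈ range (n + 1), ⟪e k, h⟫_ℂ • e k with hp
  have hpK : p ∈ Submodule.span ℂ (v '' Set.Iio (n + 1)) :=
    sum_inner_smul_gramSchmidtNormed_mem v h (n + 1)
  have hpK' : p ∈ Submodule.span ℂ (Set.range v) :=
    Submodule.span_mono (Set.image_subset_range _ _) hpK
  have hinner_p : ⟪e n, p⟫_ℂ = ⟪e n, h⟫_ℂ * ⟪e n, e n⟫_ℂ := by
    rw [hp, inner_sum, sum_eq_single_of_mem n (by simp)
      fun k _ hk => by rw [inner_smul_right, inner_gramSchmidtNormed_of_ne v hk.symm, mul_zero],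
      inner_smul_right]
  have hTp : ⟪h, T p⟫_ℂ =
      ⟪p, T p⟫_ℂ + ⟪e n, h⟫_ℂ * ⟪e (n + 1), T (e n)⟫_ℂ * ⟪h, e (n + 1)⟫_ℂ := by
    conv_lhs =>
      rw [← sum_inner_smul_gramSchmidtNormed v (map_mem_span_Iio_succ hTv hpK), sum_range_succ]
    rw [inner_add_right, inner_smul_right, inner_gramSchmidtNormed_succ_map hTv hpK]
    congr 1
    · rw [inner_sum, hp, sum_inner]
      refine sum_congr rfl fun k _ => ?_
      rw [inner_smul_right, inner_smul_left, inner_conj_symm, mul_comm]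
    · rw [← he, hinner_p, mul_assoc ⟪e n, h⟫_ℂ, ← inner_smul_right (e (n + 1)), ← map_smul,
        inner_self_smul_gramSchmidtNormed]
  have him : (⟪p, T p⟫_ℂ).im = 0 := by
    rw [← Complex.conj_eq_iff_im, inner_conj_symm, hsymm p hpK' p hpK']
  have key := hTp
  rw [hh p hpK', hp, inner_sum_inner_smul_gramSchmidtNormed, ← hp] at key
  have key_im := congrArg Complex.im key
  rw [Complex.add_im, him, zero_add, Complex.im_mul_ofReal] at key_im
  calc _ = |z.im * ∑ k ∈ range (n + 1), ‖⟪e k, h⟫_ℂ‖ ^ 2| := by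
        have : 0 ≤ ∑ k ∈ range (n + 1), ‖⟪e k, h⟫_ℂ‖ ^ 2 := sum_nonneg fun k _ => by positivity
        rw [abs_mul, abs_of_nonneg this]
    _ ≤ ‖⟪e n, h⟫_ℂ * ⟪e (n + 1), T (e n)⟫_ℂ * ⟪h, e (n + 1)⟫_ℂ‖ := by
        rw [key_im]
        exact Complex.abs_im_le_norm _
    _ = _ := by
        rw [norm_mul, norm_mul, norm_inner_symm h]
        ring

/-- The deficiency spaces of a symmetric operator restricted to the Krylov subspace of a
quasi-analytic vector are orthogonal to that subspace. -/
theorem inner_eq_zero_of_quasiAnalytic (hTv : ∀ n, T (v n) = v (n + 1))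
    (hsymm : ∀ x ∈ Submodule.span ℂ (Set.range v), ∀ y ∈ Submodule.span ℂ (Set.range v),
      ⟪T x, y⟫_ℂ = ⟪x, T y⟫_ℂ)
    (hqa : Filter.Tendsto
      (fun N => ∑ n ∈ range N, ‖v (n + 1)‖ ^ (-(1 : ℝ) / ((n : ℝ) + 1)))
      Filter.atTop Filter.atTop)
    {z : ℂ} (hz : z.im ≠ 0) {h : E}
    (hh : ∀ x ∈ Submodule.span ℂ (Set.range v), ⟪h, T x⟫_ℂ = z * ⟪h, x⟫_ℂ) :
    ∀ x ∈ Submodule.span ℂ (Set.range v), ⟪h, x⟫_ℂ = 0 := by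
  suffices h0 : ⟪h, v 0⟫_ℂ = 0 by
    have hn (n : ℕ) : ⟪h, v n⟫_ℂ = 0 := by
      induction n with
      | zero => exact h0
      | succ n ih => rw [← hTv n, hh _ (Submodule.subset_span ⟨n, rfl⟩), ih, mul_zero]
    intro x hx
    induction hx using Submodule.span_induction with
    | mem x hx =>
      obtain ⟨n, rfl⟩ := hx
      exact hn n
    | zero => exact inner_zero_right h
    | add x y _ _ hx hy => rw [inner_add_right, hx, hy, add_zero]
    | smul c x _ hx => rw [inner_smul_right, hx, mul_zero]
  by_contra h0
  set c : ℕ → ℝ := fun n => ‖⟪gramSchmidtNormed ℂ v n, h⟫_ℂ‖ with hc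
  have hv0 : ⟪gramSchmidtNormed ℂ v 0, v 0⟫_ℂ • gramSchmidtNormed ℂ v 0 = v 0 := by
    simpa using sum_inner_smul_gramSchmidtNormed v (n := 1) (x := v 0)
      (Submodule.subset_span ⟨0, by simp, rfl⟩)
  rw [← hv0, inner_smul_right] at h0
  have hC : 0 < ‖⟪gramSchmidtNormed ℂ v 0, v 0⟫_ℂ‖ := norm_pos_iff.2 (left_ne_zero_of_mul h0)
  have hc0 : 0 < c 0 := by
    rw [hc]
    simp only
    rw [norm_inner_symm]
    exact norm_pos_iff.2 (right_ne_zero_of_mul h0)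
  set δ := |z.im| * c 0 ^ 2 with hδ
  have hδ_pos : 0 < δ := mul_pos (abs_pos.2 hz) (by positivity)
  have hδ_le (n : ℕ) : δ ≤ c n * c (n + 1) *
      ‖⟪gramSchmidtNormed ℂ v (n + 1), T (gramSchmidtNormed ℂ v n)⟫_ℂ‖ := by
    refine le_trans ?_ (abs_im_mul_sum_le hTv hsymm hh n)
    exact mul_le_mul_of_nonneg_left
      (single_le_sum (f := fun k => c k ^ 2) (fun k _ => by positivity) (by simp))
      (abs_nonneg _)
  have hb (n : ℕ) : ⟪gramSchmidtNormed ℂ v (n + 1), T (gramSchmidtNormed ℂ v n)⟫_ℂ ≠ 0 := by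
    intro h
    have := hδ_le n
    rw [h, norm_zero, mul_zero] at this
    linarith
  have hsum (N : ℕ) : ∑ n ∈ range N,
      ‖⟪gramSchmidtNormed ℂ v (n + 1), T (gramSchmidtNormed ℂ v n)⟫_ℂ‖⁻¹ ≤ ‖h‖ ^ 2 / δ := by
    have hterm (n : ℕ) :
        ‖⟪gramSchmidtNormed ℂ v (n + 1), T (gramSchmidtNormed ℂ v n)⟫_ℂ‖⁻¹ ≤
          (c n ^ 2 + c (n + 1) ^ 2) / (2 * δ) := by
      rw [inv_eq_one_div, div_le_div_iff₀ (norm_pos_iff.2 (hb n)) (by positivity)]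
      have := mul_le_mul_of_nonneg_right (two_mul_le_add_sq (c n) (c (n + 1)))
        (norm_nonneg ⟪gramSchmidtNormed ℂ v (n + 1), T (gramSchmidtNormed ℂ v n)⟫_ℂ)
      have := hδ_le n
      linarith
    have h1 := sum_norm_inner_gramSchmidtNormed_sq_le v h N
    have h2 := sum_norm_inner_gramSchmidtNormed_sq_le v h (N + 1)
    rw [sum_range_succ'] at h2
    calc _ ≤ ∑ n ∈ range N, (c n ^ 2 + c (n + 1) ^ 2) / (2 * δ) :=
          sum_le_sum fun n _ => hterm n
      _ = (∑ n ∈ range N, c n ^ 2 + ∑ n ∈ range N, c (n + 1) ^ 2) / (2 * δ) := by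
          rw [← sum_div, sum_add_distrib]
      _ ≤ (‖h‖ ^ 2 + ‖h‖ ^ 2) / (2 * δ) := by
          gcongr
          have := sq_nonneg (c 0)
          linarith
      _ = _ := by
          field_simp
          ring
  obtain ⟨N, hN⟩ := (hqa.eventually_gt_atTop
    (max 1 ‖⟪gramSchmidtNormed ℂ v 0, v 0⟫_ℂ‖⁻¹ * (2 * Real.exp 1 * (‖h‖ ^ 2 / δ)))).exists
  have hw (n : ℕ) : ‖⟪gramSchmidtNormed ℂ v 0, v 0⟫_ℂ‖ * ∏ k ∈ range n,
      ‖⟪gramSchmidtNormed ℂ v (k + 1), T (gramSchmidtNormed ℂ v k)⟫_ℂ‖ ≤ ‖v n‖ := by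
    rw [← norm_inner_gramSchmidtNormed_orbit hTv]
    exact (norm_inner_le_norm _ _).trans
      (mul_le_of_le_one_left (norm_nonneg _) (norm_gramSchmidtNormed_le_one v n))
  refine absurd hN (not_lt.2
    ((sum_rpow_neg_inv_le (fun n => norm_pos_iff.2 (hb n)) hC hw N).trans ?_))
  gcongr
  exact hsum N

end Jacobi

section SelfAdjoint

variable {H : Type*} [NormedAddCommGroup H] [InnerProductSpace ℂ H]

/-- For a symmetric operator and a quasi-analytic vector, `T + z` maps the Krylov subspace onto
a dense subspace of its closure when `z` is not real. -/
theorem topologicalClosure_krylov_le [CompleteSpace H] {T : H →ₗ[ℂ] H} {v : ℕ → H}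
    (hTv : ∀ n, T (v n) = v (n + 1))
    (hsymm : ∀ x ∈ Submodule.span ℂ (Set.range v), ∀ y ∈ Submodule.span ℂ (Set.range v),
      ⟪T x, y⟫_ℂ = ⟪x, T y⟫_ℂ)
    (hqa : Filter.Tendsto
      (fun N => ∑ n ∈ range N, ‖v (n + 1)‖ ^ (-(1 : ℝ) / ((n : ℝ) + 1)))
      Filter.atTop Filter.atTop) {z : ℂ} (hz : z.im ≠ 0) :
    (Submodule.span ℂ (Set.range v)).topologicalClosure ≤
      ((Submodule.span ℂ (Set.range v)).map (T + z • LinearMap.id)).topologicalClosure := by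
  refine Submodule.topologicalClosure_minimal _ ?_ (Submodule.isClosed_topologicalClosure _)
  rw [← Submodule.orthogonal_orthogonal_eq_closure]
  refine (Submodule.le_orthogonal_orthogonal _).trans (Submodule.orthogonal_le fun h hh => ?_)
  refine (Submodule.mem_orthogonal' _ _).2
    (inner_eq_zero_of_quasiAnalytic hTv hsymm hqa (z := -z) (by simpa using hz) fun x hx => ?_)
  have := (Submodule.mem_orthogonal' _ _).1 hh _ (Submodule.mem_map_of_mem hx)
  simp only [LinearMap.add_apply, LinearMap.smul_apply, LinearMap.id_apply, inner_add_right,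
    inner_smul_right] at this
  linear_combination this

theorem norm_le_norm_add_I_smul {T : H →ₗ[ℂ] H} {x : H} (h : ⟪T x, x⟫_ℂ = ⟪x, T x⟫_ℂ) :
    ‖x‖ ≤ ‖T x + Complex.I • x‖ := by
  have hsq : ‖T x + Complex.I • x‖ ^ 2 = ‖T x‖ ^ 2 + ‖x‖ ^ 2 := by
    have him : (⟪T x, x⟫_ℂ).im = 0 := by
      rw [← Complex.conj_eq_iff_im, inner_conj_symm, h]
    rw [norm_add_sq (𝕜 := ℂ), norm_smul, inner_smul_right]
    simp [him]
  exact le_of_sq_le_sq (hsq ▸ le_add_of_nonneg_left (sq_nonneg _)) (norm_nonneg _)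

/-- The orthogonal projection onto the closed Krylov space of a quasi-analytic vector `v 0 = T u`
maps the solution `u` to a solution. The operator is `T` restricted to `D`, which is
self-adjoint by `hsymm` and `hmax`. -/
theorem starProjection_krylov_mem_and_map [CompleteSpace H] {D : Submodule ℂ H} {T : H →ₗ[ℂ] H}
    (hsymm : ∀ x ∈ D, ∀ y ∈ D, ⟪T x, y⟫_ℂ = ⟪x, T y⟫_ℂ)
    (hmax : ∀ y w, (∀ x ∈ D, ⟪w, x⟫_ℂ = ⟪y, T x⟫_ℂ) → y ∈ D ∧ T y = w)
    {v : ℕ → H} (hvD : ∀ n, v n ∈ D) (hTv : ∀ n, T (v n) = v (n + 1))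
    {u : H} (huD : u ∈ D) (hTu : T u = v 0)
    (hqa : Filter.Tendsto
      (fun N => ∑ n ∈ range N, ‖v (n + 1)‖ ^ (-(1 : ℝ) / ((n : ℝ) + 1)))
      Filter.atTop Filter.atTop) :
    (Submodule.span ℂ (Set.range v)).topologicalClosure.starProjection u ∈ D ∧
      T ((Submodule.span ℂ (Set.range v)).topologicalClosure.starProjection u) = v 0 := by
  set K := Submodule.span ℂ (Set.range v)
  set P := K.topologicalClosure.starProjection
  have hKD : K ≤ D := Submodule.span_le.2 (Set.range_subset_iff.2 hvD)
  have hPmem (x : H) : P x ∈ K.topologicalClosure := K.topologicalClosure.starProjection_apply_mem x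
  have hTK : ∀ x ∈ K, T x ∈ K := fun x hx => by
    refine (Submodule.span_le.2 ?_ : K ≤ K.comap T) hx
    rintro _ ⟨n, rfl⟩
    exact Submodule.subset_span ⟨n + 1, (hTv n).symm⟩
  have hsymmK : ∀ x ∈ K, ∀ y ∈ K, ⟪T x, y⟫_ℂ = ⟪x, T y⟫_ℂ :=
    fun x hx y hy => hsymm x (hKD hx) y (hKD hy)
  have hw : v 0 + Complex.I • P u ∈ K.topologicalClosure :=
    add_mem (K.le_topologicalClosure (Submodule.subset_span ⟨0, rfl⟩))
      (Submodule.smul_mem _ _ (hPmem u))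
  obtain ⟨s, hs, hs_lim⟩ := mem_closure_iff_seq_limit.1
    (topologicalClosure_krylov_le hTv hsymmK hqa (z := Complex.I) (by simp) hw)
  choose p hpK hp using hs
  have hp' (n : ℕ) : T (p n) + Complex.I • p n = s n := hp n
  have hcauchy : CauchySeq p := by
    rw [Metric.cauchySeq_iff']
    intro ε hε
    obtain ⟨N, hN⟩ := Metric.cauchySeq_iff'.1 hs_lim.cauchySeq ε hε
    refine ⟨N, fun n hn => lt_of_le_of_lt ?_ (hN n hn)⟩
    have hmem : p n - p N ∈ K := sub_mem (hpK n) (hpK N)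
    rw [dist_eq_norm, dist_eq_norm]
    refine (norm_le_norm_add_I_smul (hsymmK _ hmem _ hmem)).trans_eq ?_
    rw [← hp' n, ← hp' N, map_sub, smul_sub]
    congr 1
    abel
  obtain ⟨q, hq⟩ := cauchySeq_tendsto_of_complete hcauchy
  have hTp : Filter.Tendsto (fun n => T (p n)) Filter.atTop
      (nhds (v 0 + Complex.I • P u - Complex.I • q)) := by
    refine (hs_lim.sub (hq.const_smul Complex.I)).congr fun n => ?_
    rw [← hp' n, add_sub_cancel_right]
  obtain ⟨hqD, hTq⟩ := hmax q _ fun x hx => tendsto_nhds_unique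
    (hTp.inner tendsto_const_nhds)
    ((hq.inner (tendsto_const_nhds (x := T x))).congr fun n =>
      (hsymm _ (hKD (hpK n)) x hx).symm)
  have hqK : q ∈ K.topologicalClosure :=
    mem_closure_of_tendsto hq (Filter.Eventually.of_forall hpK)
  have hd_orth : ∀ y ∈ K.map (T + (-Complex.I) • LinearMap.id), ⟪q - u, y⟫_ℂ = 0 := by
    rintro _ ⟨k, hk, rfl⟩
    have hPu : ⟪P u, k⟫_ℂ = ⟪u, k⟫_ℂ := by
      have := K.topologicalClosure.starProjection_inner_eq_zero u k
        (K.le_topologicalClosure hk)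
      rw [inner_sub_left, sub_eq_zero] at this
      exact this.symm
    have hTd := hsymm (q - u) (sub_mem hqD huD) k (hKD hk)
    rw [map_sub, hTq, hTu] at hTd
    simp only [inner_sub_left, inner_add_left, inner_smul_left, Complex.conj_I] at hTd
    simp only [LinearMap.add_apply, LinearMap.smul_apply, LinearMap.id_apply, inner_add_right,
      inner_smul_right, inner_sub_left]
    rw [hPu] at hTd
    linear_combination -hTd
  have hPq : P u = q := by
    refine K.topologicalClosure.eq_starProjection_of_mem_of_inner_eq_zero hqK fun y hy => ?_
    have hy' := topologicalClosure_krylov_le hTv hsymmK hqa (z := -Complex.I) (by simp) hy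
    have : q - u ∈ (K.map (T + (-Complex.I) • LinearMap.id))ᗮ :=
      (Submodule.mem_orthogonal' _ _).2 hd_orth
    rw [← Submodule.orthogonal_closure] at this
    rw [← neg_sub, inner_neg_left, (Submodule.mem_orthogonal' _ _).1 this y hy', neg_zero]
  rw [hPq]
  refine ⟨hqD, ?_⟩
  rw [hTq, hPq, add_sub_cancel_right]

/-- A kernel vector in the closed Krylov space of a vector in the range vanishes. -/
theorem eq_zero_of_mem_closure_krylov {D : Submodule ℂ H} {T : H →ₗ[ℂ] H}
    (hsymm : ∀ x ∈ D, ∀ y ∈ D, ⟪T x, y⟫_ℂ = ⟪x, T y⟫_ℂ)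
    {v : ℕ → H} (hvD : ∀ n, v n ∈ D) (hTv : ∀ n, T (v n) = v (n + 1))
    {u : H} (huD : u ∈ D) (hTu : T u = v 0) {d : H} (hdD : d ∈ D) (hTd : T d = 0)
    (hd : d ∈ (Submodule.span ℂ (Set.range v)).topologicalClosure) : d = 0 := by
  have hle : (Submodule.span ℂ (Set.range v)).topologicalClosure ≤ (ℂ ∙ d)ᗮ := by
    refine Submodule.topologicalClosure_minimal _ (Submodule.span_le.2 ?_)
      (Submodule.isClosed_orthogonal _)
    rintro _ ⟨n, rfl⟩
    refine Submodule.mem_orthogonal_singleton_iff_inner_left.2 ?_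
    cases n with
    | zero => rw [← hTu, hsymm u huD d hdD, hTd, inner_zero_right]
    | succ n => rw [← hTv n, hsymm _ (hvD n) d hdD, hTd, inner_zero_right]
  exact inner_self_eq_zero.1 (Submodule.mem_orthogonal_singleton_iff_inner_left.1 (hle hd))

theorem existsUnique_krylov_solution [CompleteSpace H] {D : Submodule ℂ H} {T : H →ₗ[ℂ] H}
    (hsymm : ∀ x ∈ D, ∀ y ∈ D, ⟪T x, y⟫_ℂ = ⟪x, T y⟫_ℂ)
    (hmax : ∀ y w, (∀ x ∈ D, ⟪w, x⟫_ℂ = ⟪y, T x⟫_ℂ) → y ∈ D ∧ T y = w)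
    {v : ℕ → H} (hvD : ∀ n, v n ∈ D) (hTv : ∀ n, T (v n) = v (n + 1))
    {u : H} (huD : u ∈ D) (hTu : T u = v 0)
    (hqa : Filter.Tendsto
      (fun N => ∑ n ∈ range N, ‖v (n + 1)‖ ^ (-(1 : ℝ) / ((n : ℝ) + 1)))
      Filter.atTop Filter.atTop) :
    ∃! f : H, f ∈ (Submodule.span ℂ (Set.range v)).topologicalClosure ∧ f ∈ D ∧ T f = v 0 := by
  refine ⟨_, ⟨Submodule.starProjection_apply_mem _ u,
    starProjection_krylov_mem_and_map hsymm hmax hvD hTv huD hTu hqa⟩, ?_⟩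
  rintro f ⟨hf, hfD, hTf⟩
  obtain ⟨hD, hT⟩ := starProjection_krylov_mem_and_map hsymm hmax hvD hTv huD hTu hqa
  refine sub_eq_zero.1 (eq_zero_of_mem_closure_krylov hsymm hvD hTv huD hTu (sub_mem hfD hD) ?_
    (sub_mem hf (Submodule.starProjection_apply_mem _ u)))
  rw [map_sub, hTf, hT, sub_self]

end SelfAdjoint

theorem span_range_pow_smul {E : Type*} [AddCommGroup E] [Module ℂ E] {c : ℂ} (hc : c ≠ 0)
    (v : ℕ → E) :
    Submodule.span ℂ (Set.range fun n => c ^ (n + 1) • v n) = Submodule.span ℂ (Set.range v) := by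
  refine le_antisymm (Submodule.span_le.2 ?_) (Submodule.span_le.2 ?_)
  · rintro _ ⟨n, rfl⟩
    exact Submodule.smul_mem _ _ (Submodule.subset_span ⟨n, rfl⟩)
  · rintro _ ⟨n, rfl⟩
    exact (Submodule.smul_mem_iff _ (pow_ne_zero (n + 1) hc)).1 (Submodule.subset_span ⟨n, rfl⟩)


/-- **Krylov solvability for (possibly unbounded) self-adjoint or skew-adjoint operators.**
Let `A` be a densely defined operator on a complex Hilbert space `H` that is self-adjoint
(`A† = A`) or skew-adjoint (`A† = -A`), and let `g ∈ ran A` be a quasi-analytic vector for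
`A`. Here the orbit `v n = Aⁿ g` (so in particular `g ∈ dom Aⁿ` for every `n`) is encoded by
a sequence `v` with `v 0 = g` and `v (n+1) = A (v n)`, and quasi-analyticity means that the
series `∑_{n ≥ 1} ‖Aⁿ g‖^(-1/n)` diverges to `+∞`. Then there is a unique Krylov solution to
`A f = g`, i.e. a unique `f` in the closure of `K(A,g) = span {Aⁿ g : n ∈ ℕ}` with
`f ∈ dom A` and `A f = g`. -/
theorem selfAdjoint_or_skewAdjoint_unique_krylov_solution
    {H : Type*} [NormedAddCommGroup H] [InnerProductSpace ℂ H] [CompleteSpace H]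
    (A : H →ₗ.[ℂ] H) (hdense : Dense (A.domain : Set H))
    (hA : A.adjoint = A ∨ A.adjoint = -A)
    (g : H) (hg : ∃ u : A.domain, A u = g)
    (v : ℕ → H) (hv0 : v 0 = g)
    (hv : ∀ n : ℕ, ∃ h : v n ∈ A.domain, A ⟨v n, h⟩ = v (n + 1))
    (hqa : Filter.Tendsto
      (fun N => ∑ n ∈ Finset.range N, ‖v (n + 1)‖ ^ (-(1 : ℝ) / ((n : ℝ) + 1)))
      Filter.atTop Filter.atTop) :
    ∃! f : H, f ∈ (Submodule.span ℂ (Set.range v)).topologicalClosure ∧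
      ∃ hf : f ∈ A.domain, A ⟨f, hf⟩ = g := by
  obtain ⟨T, hT⟩ := LinearMap.exists_extend A.toFun
  have hTA (x : H) (hx : x ∈ A.domain) : T x = A ⟨x, hx⟩ := LinearMap.congr_fun hT ⟨x, hx⟩
  obtain ⟨u, hu⟩ := hg
  have hvD (n : ℕ) : v n ∈ A.domain := (hv n).1
  have hTv (n : ℕ) : T (v n) = v (n + 1) := (hTA _ (hvD n)).trans (hv n).2
  have hTu : T u = v 0 := by rw [hTA u u.2, hv0, ← hu]
  have hsol (f : H) : (∃ hf : f ∈ A.domain, A ⟨f, hf⟩ = g) ↔ f ∈ A.domain ∧ T f = v 0 := by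
    rw [hv0, ← exists_prop]
    exact exists_congr fun hf => by rw [hTA f hf]
  simp only [hsol]
  have hadj := A.adjoint_isFormalAdjoint hdense
  have hadj_mem (y w : H) (h : ∀ x ∈ A.domain, ⟪w, x⟫_ℂ = ⟪y, T x⟫_ℂ) :
      ∃ hy : y ∈ A.adjoint.domain, A.adjoint ⟨y, hy⟩ = w := by
    have h' : ∀ x : A.domain, ⟪w, (x : H)⟫_ℂ = ⟪y, A x⟫_ℂ := fun x => by
      rw [h x x.2, hTA x x.2]
    exact ⟨A.mem_adjoint_domain_of_exists y ⟨w, h'⟩, A.adjoint_apply_eq hdense _ h'⟩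
  rcases hA with hA | hA
  · rw [hA] at hadj hadj_mem
    refine existsUnique_krylov_solution (fun x hx y hy => ?_) (fun y w h => ?_) hvD hTv u.2 hTu hqa
    · rw [hTA x hx, hTA y hy]
      exact hadj ⟨x, hx⟩ ⟨y, hy⟩
    · obtain ⟨hy, hw⟩ := hadj_mem y w h
      exact ⟨hy, (hTA y hy).trans hw⟩
  · rw [hA] at hadj hadj_mem
    have hsol_I (f : H) : T f = v 0 ↔ (Complex.I • T) f = Complex.I ^ (0 + 1) • v 0 := by
      rw [zero_add, pow_one, LinearMap.smul_apply, smul_right_inj Complex.I_ne_zero]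
    simp only [hsol_I, ← span_range_pow_smul Complex.I_ne_zero v]
    refine existsUnique_krylov_solution (v := fun n => Complex.I ^ (n + 1) • v n)
      (fun x hx y hy => ?_) (fun y w h => ?_)
      (fun n => Submodule.smul_mem _ _ (hvD n)) (fun n => ?_) u.2 ((hsol_I u).1 hTu) ?_
    · have := hadj ⟨x, hx⟩ ⟨y, hy⟩
      rw [LinearPMap.neg_apply, inner_neg_left, ← hTA x hx, ← hTA y hy] at this
      rw [LinearMap.smul_apply, LinearMap.smul_apply, inner_smul_left, inner_smul_right,
        Complex.conj_I, ← this]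
      ring
    · obtain ⟨hy, hw⟩ := hadj_mem y (Complex.I • w) fun x hx => by
        rw [inner_smul_left, h x hx, LinearMap.smul_apply, inner_smul_right, Complex.conj_I,
          ← mul_assoc, neg_mul, Complex.I_mul_I, neg_neg, one_mul]
      refine ⟨hy, ?_⟩
      rw [LinearPMap.neg_apply, ← hTA y hy] at hw
      rw [LinearMap.smul_apply, ← neg_neg (T y), hw, smul_neg, smul_smul, Complex.I_mul_I,
        neg_smul, one_smul, neg_neg]
    · rw [LinearMap.smul_apply, map_smul, hTv, smul_smul, ← pow_succ']
    · simpa [norm_smul] using hqa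
end

section
/- Let R be the right-shift operator on ℓ²(ℤ), defined by (R f)(n) = f(n-1) (equivalently, R e_n = e_{n+1} on the canonical basis vectors). Let g ∈ ℓ²(ℤ) be a nonzero finitely supported vector (a finite linear combination of canonical basis vectors). Then the unique solution f to R f = g, namely the left shift f = R* g given by f(n) = g(n+1), does NOT belong to the closure of the Krylov subspace K(R,g). -/
/-- A continuous linear functional vanishing on the orbit of `g` under `A` vanishes on the closure
of the Krylov subspace. -/
theorem eq_zero_of_mem_closure_krylov_s12 {H : Type*} [NormedAddCommGroup H] [InnerProductSpace ℂ H]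
    {A : H →L[ℂ] H} {g : H} (φ : H →L[ℂ] ℂ) (hφ : ∀ n : ℕ, φ ((A ^ n) g) = 0)
    {f : H} (hf : f ∈ (krylov A g).topologicalClosure) : φ f = 0 := by
  have hle : krylov A g ≤ φ.ker := by
    refine Submodule.span_le.2 ?_
    rintro _ ⟨n, rfl⟩
    exact hφ n
  exact Submodule.topologicalClosure_minimal _ hle φ.isClosed_ker hf

/-- The powers of the right shift are the translations by natural numbers. -/
theorem rightShift_pow_apply (R : lp (fun _ : ℤ => ℂ) 2 →L[ℂ] lp (fun _ : ℤ => ℂ) 2)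
    (hR : ∀ (u : lp (fun _ : ℤ => ℂ) 2) (n : ℤ), R u n = u (n - 1))
    (u : lp (fun _ : ℤ => ℂ) 2) (k : ℕ) (n : ℤ) : (R ^ k) u n = u (n - k) := by
  induction k generalizing n with
  | zero => simp
  | succ k ih =>
    rw [pow_succ', mul_apply_eq_comp, hR, ih, Nat.cast_succ, sub_sub, add_comm]

/-- Let `R` be the right shift on `ℓ²(ℤ)`, i.e. `(R f) n = f (n - 1)`, and let `g` be a
nonzero finitely supported vector. Then the unique solution `f` of `R f = g`, namely the
left shift `f n = g (n + 1)`, does not belong to the closure of the Krylov subspace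
`K(R,g)`. -/
theorem rightShift_finitelySupported_not_krylovSolvable
    (R : lp (fun _ : ℤ => ℂ) 2 →L[ℂ] lp (fun _ : ℤ => ℂ) 2)
    (hR : ∀ (u : lp (fun _ : ℤ => ℂ) 2) (n : ℤ), R u n = u (n - 1))
    (g : lp (fun _ : ℤ => ℂ) 2) (hg₀ : g ≠ 0)
    (hgfin : {n : ℤ | g n ≠ 0}.Finite)
    (f : lp (fun _ : ℤ => ℂ) 2) (hf : ∀ n : ℤ, f n = g (n + 1)) :
    f ∉ (krylov R g).topologicalClosure := by
  obtain ⟨m, hm, hmin⟩ := hgfin.exists_minimal (by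
    by_contra hempty
    refine hg₀ (lp.ext (funext fun n => ?_))
    by_contra hn
    exact hempty ⟨n, hn⟩)
  have hvanish : ∀ n < m, g n = 0 := fun n hn => by
    by_contra hne
    exact absurd (hmin hne hn.le) hn.not_ge
  intro hmem
  have hzero := eq_zero_of_mem_closure_krylov_s12 (lp.evalCLM ℂ (fun _ : ℤ => ℂ) 2 (m - 1))
    (fun k => (rightShift_pow_apply R hR g k (m - 1)).trans (hvanish _ (by omega))) hmem
  change f (m - 1) = 0 at hzero
  rw [hf, sub_add_cancel] at hzero
  exact hm hzero
end

section
/- Let R be the right-shift operator on ℓ²(ℤ), defined by (R f)(n) = f(n-1). Then the set of cyclic vectors of R, i.e., the set of g ∈ ℓ²(ℤ) such that the closure of K(R,g) = span{R^n g : n ≥ 0} is all of ℓ²(ℤ), is dense in ℓ²(ℤ). -/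
open MeasureTheory Filter Topology AddCircle ContinuousMap
open scoped ComplexConjugate

section BanachAlgebra

variable {B : Type*} [NormedCommRing B] [NormedAlgebra ℂ B] [CompleteSpace B]

/-- A norm-closed subalgebra contains the inverse of `1 - x` for each of its elements `x` with
`‖x‖ < 1`. -/
lemma Subalgebra.exists_one_sub_mul_eq_one {A : Subalgebra ℂ B} (hA : IsClosed (A : Set B))
    {x : B} (hx : x ∈ A) (hx1 : ‖x‖ < 1) : ∃ q ∈ A, (1 - x) * q = 1 :=
  ⟨∑' i : ℕ, x ^ i,
    hA.mem_of_tendsto (summable_geometric_of_norm_lt_one hx1).hasSum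
      (Eventually.of_forall fun _ => A.sum_mem fun i _ => A.pow_mem hx i),
    mul_neg_geom_series x hx1⟩

/-- If a norm-closed subalgebra contains `z` and `b`, then `exp (z * b) - 1` is divisible by the
unit `z` within the subalgebra. -/
lemma Subalgebra.inv_mul_exp_sub_one_mem {A : Subalgebra ℂ B} (hA : IsClosed (A : Set B))
    {z zi b : B} (hz : z ∈ A) (hzi : zi * z = 1) (hb : b ∈ A) :
    zi * (NormedSpace.exp (z * b) - 1) ∈ A := by
  have h := (hasSum_nat_add_iff' 1).2 (NormedSpace.exp_series_hasSum_exp' (𝕂 := ℂ) (z * b))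
  simp only [Finset.sum_range_one, Nat.factorial_zero, Nat.cast_one, inv_one, pow_zero,
    one_smul] at h
  refine hA.mem_of_tendsto (h.mul_left zi)
    (Eventually.of_forall fun _ => A.sum_mem fun i _ => ?_)
  have : zi * (((i + 1).factorial⁻¹ : ℂ) • (z * b) ^ (i + 1)) =
      ((i + 1).factorial⁻¹ : ℂ) • ((z * b) ^ i * b) := by
    rw [mul_smul_comm, pow_succ]
    congr 1
    linear_combination (z * b) ^ i * b * hzi
  rw [this]
  exact A.smul_mem (A.mul_mem (A.pow_mem (A.mul_mem hz hb) i) hb) _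

end BanachAlgebra

/-- An upper bound for the Poisson kernel `Re ((1 + r w) / (1 - r w))` on the unit circle. -/
lemma re_poisson_le {w q : ℂ} {r : ℝ} (hw : ‖w‖ = 1) (hw1 : w ≠ 1) (hr0 : 0 ≤ r) (hr1 : r < 1)
    (hq : (1 - r * w) * q = 1) :
    (2 * r * (w * q)).re ≤ 8 * (1 - r) / ‖1 - w‖ ^ 2 - 1 := by
  have hd : 0 < ‖1 - w‖ := norm_pos_iff.2 (sub_ne_zero.2 hw1.symm)
  have hne : 1 - r * w ≠ 0 := left_ne_zero_of_mul_eq_one hq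
  have hD : 0 < ‖1 - r * w‖ := norm_pos_iff.2 hne
  have hq' : q = (1 - r * w)⁻¹ := eq_inv_of_mul_eq_one_right hq
  have hsq : w.re ^ 2 + w.im ^ 2 = 1 := by
    have := Complex.sq_norm w
    rw [hw, Complex.normSq_apply] at this
    linarith
  have hDsq : ‖1 - r * w‖ ^ 2 = 1 - 2 * r * w.re + r ^ 2 := by
    rw [Complex.sq_norm, Complex.normSq_apply]
    simp
    linear_combination r ^ 2 * hsq
  have hdsq : ‖1 - w‖ ^ 2 = 2 - 2 * w.re := by
    rw [Complex.sq_norm, Complex.normSq_apply]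
    simp
    linear_combination hsq
  have hre : (2 * r * (w * q)).re = (1 - r ^ 2) / ‖1 - r * w‖ ^ 2 - 1 := by
    have hqre : q.re = (1 - r * w.re) / ‖1 - r * w‖ ^ 2 := by
      rw [hq', Complex.inv_re, Complex.normSq_eq_norm_sq]
      simp
    have hqim : q.im = r * w.im / ‖1 - r * w‖ ^ 2 := by
      rw [hq', Complex.inv_im, Complex.normSq_eq_norm_sq]
      simp
    have h1 : (2 * r * (w * q)).re = 2 * r * (w.re - r) / ‖1 - r * w‖ ^ 2 := by
      have : (2 * r * (w * q)).re = 2 * r * (w.re * q.re - w.im * q.im) := by simp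
      rw [this, hqre, hqim]
      field_simp
      linear_combination (-r ^ 2) * hsq
    rw [h1, eq_sub_iff_add_eq, div_add_one (by positivity)]
    congr 1
    rw [hDsq]
    ring
  rw [hre, sub_le_sub_iff_right, div_le_div_iff₀ (by positivity) (by positivity), hDsq, hdsq]
  have hre1 : w.re ≤ 1 := by nlinarith [sq_nonneg w.im]
  have h1 : 0 ≤ 4 * (1 - 2 * r * w.re + r ^ 2) - (1 + r) * (1 - w.re) := by
    nlinarith [mul_nonneg hr0 (sub_nonneg.2 hre1), sq_nonneg (1 - r), sq_nonneg (w.re - r)]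
  nlinarith [mul_nonneg (sub_nonneg.2 hr1.le) h1]

section ContinuousFunctions

variable {X : Type*} [TopologicalSpace X]

/-- The continuous function `exp (-ε / ‖1 - z‖ ^ 2)`, extended by `0` to the set `z = 1`. -/
noncomputable def expNegWeight (z : C(X, ℂ)) (ε : ℝ) : C(X, ℂ) where
  toFun x := (expNegInvGlue (‖1 - z x‖ ^ 2 / ε) : ℝ)
  continuous_toFun := Complex.continuous_ofReal.comp
    ((expNegInvGlue.contDiff (n := 0)).continuous.comp (by fun_prop))

lemma expNegWeight_of_eq_one {z : C(X, ℂ)} {ε : ℝ} {x : X} (h : z x = 1) :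
    expNegWeight z ε x = 0 := by
  simp [expNegWeight, h]

lemma expNegWeight_of_ne_one {z : C(X, ℂ)} {ε : ℝ} (hε : 0 < ε) {x : X} (h : z x ≠ 1) :
    expNegWeight z ε x = (Real.exp (-(ε / ‖1 - z x‖ ^ 2)) : ℝ) := by
  have hd : 0 < ‖1 - z x‖ := norm_pos_iff.2 (sub_ne_zero.2 h.symm)
  have : ¬ ‖1 - z x‖ ^ 2 / ε ≤ 0 := not_le.2 (by positivity)
  simp [expNegWeight, expNegInvGlue, this]

lemma norm_expNegWeight_le_one (z : C(X, ℂ)) {ε : ℝ} (hε : 0 < ε) (x : X) :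
    ‖expNegWeight z ε x‖ ≤ 1 := by
  by_cases h : z x = 1
  · simp [expNegWeight_of_eq_one h]
  · rw [expNegWeight_of_ne_one hε h, Complex.norm_real, Real.norm_eq_abs, Real.abs_exp,
      Real.exp_le_one_iff, neg_nonpos]
    positivity

variable [CompactSpace X]

/-- Within the closed algebra generated by a unimodular function `z`, there are elements
close to `z⁻¹` in the uniform norm weighted by `expNegWeight z ε`. -/
lemma exists_mem_elemental_norm_inv_sub_mul_le {z zi : C(X, ℂ)} (hz : ∀ x, ‖z x‖ = 1)
    (hzi : zi * z = 1) {ε M : ℝ} (hε : 0 < ε) (hM : ε ≤ 8 * M) :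
    ∃ c ∈ Algebra.elemental ℂ z, ‖(zi - c) * expNegWeight z ε‖ ≤ Real.exp (-M) := by
  have hM0 : 0 < M := by linarith
  set A := Algebra.elemental ℂ z
  have hA : IsClosed (A : Set C(X, ℂ)) := Algebra.elemental.isClosed ℂ z
  have hzA : z ∈ A := Algebra.elemental.self_mem ℂ z
  set r : ℝ := 1 - ε / (8 * M) with hr
  have hr0 : 0 ≤ r := by
    rw [hr, sub_nonneg, div_le_one (by positivity)]
    exact hM
  have hr1 : r < 1 := by
    rw [hr]
    have : 0 < ε / (8 * M) := by positivity
    linarith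
  have hrz : ‖(r : ℂ) • z‖ < 1 := by
    refine lt_of_le_of_lt ((ContinuousMap.norm_le _ hr0).2 fun x => ?_) hr1
    simp [hz, abs_of_nonneg hr0]
  obtain ⟨q, hqA, hq⟩ := Subalgebra.exists_one_sub_mul_eq_one hA (A.smul_mem hzA (r : ℂ)) hrz
  have key := Subalgebra.inv_mul_exp_sub_one_mem hA hzA hzi (A.smul_mem hqA (2 * M * r : ℂ))
  refine ⟨_, A.neg_mem key, ?_⟩
  rw [ContinuousMap.norm_le _ (Real.exp_pos _).le]
  intro x
  have hexp : NormedSpace.exp (z * ((2 * M * r : ℂ) • q)) x =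
      Complex.exp (M * (2 * r * (z x * q x))) := by
    have := NormedSpace.map_exp (ContinuousMap.evalAlgHom ℂ ℂ x)
      (continuous_eval_const x) (z * ((2 * M * r : ℂ) • q))
    rw [← Complex.exp_eq_exp_ℂ] at this
    refine this.trans (congrArg _ ?_)
    change z x * ((2 * M * r : ℂ) * q x) = _
    ring
  have hzix : ‖zi x‖ = 1 := by
    have := congrArg norm (DFunLike.congr_fun hzi x)
    simpa [hz] using this
  have hval : ((zi - -(zi * (NormedSpace.exp (z * ((2 * M * r : ℂ) • q)) - 1))) *
      expNegWeight z ε) x =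
      zi x * Complex.exp (M * (2 * r * (z x * q x))) * expNegWeight z ε x := by
    simp only [ContinuousMap.mul_apply, ContinuousMap.sub_apply, ContinuousMap.neg_apply,
      ContinuousMap.one_apply, hexp]
    ring
  rw [hval]
  by_cases h : z x = 1
  · simp [expNegWeight_of_eq_one h, Real.exp_nonneg]
  · rw [expNegWeight_of_ne_one hε h, norm_mul, norm_mul, hzix, one_mul, Complex.norm_exp,
      Complex.norm_real, Real.norm_eq_abs, Real.abs_exp, ← Real.exp_add, Real.exp_le_exp,
      Complex.re_ofReal_mul]
    have hqx : (1 - r * z x) * q x = 1 := by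
      have := DFunLike.congr_fun hq x
      simpa using this
    have hb := mul_le_mul_of_nonneg_left (re_poisson_le (hz x) h hr0 hr1 hqx) hM0.le
    have : M * (8 * (1 - r) / ‖1 - z x‖ ^ 2 - 1) = ε / ‖1 - z x‖ ^ 2 - M := by
      rw [hr]
      field_simp
      ring
    linarith

/-- The closed submodule of `C(X, ℂ)` generated by `u * expNegWeight z ε` over the closed algebra
generated by the unimodular function `z` is stable under multiplication by `z⁻¹`. -/
lemma inv_mul_mem_closure_elemental_mul {z zi : C(X, ℂ)} (hz : ∀ x, ‖z x‖ = 1)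
    (hzi : zi * z = 1) {ε : ℝ} (hε : 0 < ε) (u : C(X, ℂ)) {f : C(X, ℂ)}
    (hf : f ∈ closure ((· * (u * expNegWeight z ε)) '' (Algebra.elemental ℂ z : Set C(X, ℂ)))) :
    zi * f ∈ closure ((· * (u * expNegWeight z ε)) '' (Algebra.elemental ℂ z : Set C(X, ℂ))) := by
  rw [← closure_closure]
  refine map_mem_closure (by fun_prop : Continuous fun f : C(X, ℂ) => zi * f) hf ?_
  rintro _ ⟨b, hb, rfl⟩
  rw [Metric.mem_closure_iff]
  intro δ hδ
  have hlim : Tendsto (fun M : ℝ => ‖b * u‖ * Real.exp (-M)) atTop (𝓝 0) := by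
    simpa using Real.tendsto_exp_neg_atTop_nhds_zero.const_mul ‖b * u‖
  obtain ⟨M, hMδ, hM⟩ := ((hlim.eventually_lt_const hδ).and
    (eventually_ge_atTop (ε / 8))).exists
  obtain ⟨c, hc, hcM⟩ := exists_mem_elemental_norm_inv_sub_mul_le hz hzi hε
    (by linarith : ε ≤ 8 * M)
  refine ⟨_, ⟨c * b, mul_mem hc hb, rfl⟩, ?_⟩
  rw [dist_eq_norm]
  calc ‖zi * (b * (u * expNegWeight z ε)) - c * b * (u * expNegWeight z ε)‖
      = ‖b * u * ((zi - c) * expNegWeight z ε)‖ := by congr 1; ring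
    _ ≤ ‖b * u‖ * Real.exp (-M) := (norm_mul_le _ _).trans (by gcongr)
    _ < δ := hMδ

end ContinuousFunctions

section ContinuousMapToL2

variable {X : Type*} [TopologicalSpace X] [CompactSpace X]
  [MeasurableSpace X] [BorelSpace X] {μ : Measure X} [IsFiniteMeasure μ]

/-- Dominated convergence for uniformly bounded sequences of continuous functions in `L²`. -/
lemma tendsto_toLp_two_of_ae {f : ℕ → C(X, ℂ)} {g : C(X, ℂ)} {C : ℝ}
    (hf : ∀ n x, ‖f n x‖ ≤ C) (hlim : ∀ᵐ x ∂μ, Tendsto (fun n => f n x) atTop (𝓝 (g x))) :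
    Tendsto (fun n => ContinuousMap.toLp 2 μ ℂ (f n)) atTop
      (𝓝 (ContinuousMap.toLp 2 μ ℂ g)) := by
  rw [tendsto_iff_norm_sub_tendsto_zero]
  have hsq : ∀ n, ‖ContinuousMap.toLp 2 μ ℂ (f n) - ContinuousMap.toLp 2 μ ℂ g‖ ^ 2 =
      ∫ x, ‖f n x - g x‖ ^ 2 ∂μ := by
    intro n
    rw [← map_sub, ← Complex.ofReal_inj, ← integral_complex_ofReal]
    have := inner_self_eq_norm_sq_to_K (𝕜 := ℂ) (ContinuousMap.toLp 2 μ ℂ (f n - g))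
    rw [ContinuousMap.inner_toLp] at this
    push_cast
    rw [← Complex.coe_algebraMap] at *
    refine this.symm.trans (integral_congr_ae (Eventually.of_forall fun x => ?_))
    exact Complex.mul_conj' _
  have h0 : Tendsto (fun n => ∫ x, ‖f n x - g x‖ ^ 2 ∂μ) atTop (𝓝 (∫ _, (0 : ℝ) ∂μ)) := by
    refine tendsto_integral_of_dominated_convergence (fun _ => (C + ‖g‖) ^ 2) (fun n => ?_)
      (integrable_const _) (fun n => ?_) ?_
    · exact (by fun_prop : Continuous fun x => ‖f n x - g x‖ ^ 2).aestronglyMeasurable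
    · refine Eventually.of_forall fun x => ?_
      rw [norm_pow, norm_norm]
      gcongr
      exact (norm_sub_le _ _).trans (add_le_add (hf n x) (g.norm_coe_le_norm x))
    · filter_upwards [hlim] with x hx
      simpa using ((hx.sub_const (g x)).norm.pow 2)
  rw [integral_zero] at h0
  simp_rw [← hsq] at h0
  simpa using h0.sqrt

/-- If `G` is almost everywhere nonzero, then the multiples of `G` by continuous functions have
trivial orthogonal complement in `L²`. -/
lemma eq_zero_of_inner_toLp_mul_eq_zero [T2Space X] [μ.WeaklyRegular] {G : C(X, ℂ)}
    (hG : ∀ᵐ x ∂μ, G x ≠ 0) {w : Lp ℂ 2 μ}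
    (hw : ∀ f : C(X, ℂ), inner ℂ (ContinuousMap.toLp 2 μ ℂ (f * G)) w = 0) :
    w = 0 := by
  have hmem : MemLp (fun x => conj (G x) * w x) 2 μ :=
    (Lp.memLp w).of_le_mul (c := ‖G‖)
      ((by fun_prop : Continuous fun x => conj (G x)).aestronglyMeasurable.mul
        (Lp.aestronglyMeasurable w))
      (Eventually.of_forall fun x => by
        rw [norm_mul, RCLike.norm_conj]
        gcongr
        exact G.norm_coe_le_norm x)
  have h0 : hmem.toLp = 0 := by
    refine (ContinuousMap.toLp_denseRange ℂ μ ℂ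
      (by simp : (2 : ENNReal) ≠ ⊤)).eq_zero_of_inner_right ℂ fun f => ?_
    rw [← hw f, L2.inner_def, L2.inner_def]
    refine integral_congr_ae ?_
    filter_upwards [hmem.coeFn_toLp, ContinuousMap.coeFn_toLp (p := 2) (𝕜 := ℂ) μ f,
      ContinuousMap.coeFn_toLp (p := 2) (𝕜 := ℂ) μ (f * G)] with x h1 h2 h3
    rw [h1, h2, h3]
    simp
    ring
  refine Lp.ext ?_
  have h1 := hmem.coeFn_toLp
  rw [h0] at h1
  filter_upwards [h1, hG, Lp.coeFn_zero ℂ 2 μ] with x hx hGx hz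
  rw [hz] at hx ⊢
  simpa [hGx] using hx.symm

/-- The almost everywhere nonzero functions are dense in `C(X, ℂ)`. -/
lemma dense_ae_ne_zero : Dense {u : C(X, ℂ) | ∀ᵐ x ∂μ, u x ≠ 0} := by
  intro u
  have hD : Dense {c : ℂ | 0 < μ {x | u x = c}}ᶜ :=
    (Measure.countable_meas_level_set_pos u.continuous.measurable).dense_compl ℂ
  have := map_mem_closure (f := fun c : ℂ => u - ContinuousMap.const X c)
    (continuous_const.sub ContinuousMap.continuous_const') (hD 0)
    (t := {u : C(X, ℂ) | ∀ᵐ x ∂μ, u x ≠ 0}) ?_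
  · simpa using this
  · intro c hc
    simpa [ae_iff, sub_eq_zero] using hc

end ContinuousMapToL2

section Circle

lemma fourier_add_eq_mul {T : ℝ} (m n : ℤ) :
    (fourier (m + n) : C(AddCircle T, ℂ)) = fourier m * fourier n :=
  ContinuousMap.ext fun _ => fourier_add

lemma ae_fourier_one_ne_one : ∀ᵐ x : AddCircle (1 : ℝ) ∂haarAddCircle, fourier 1 x ≠ 1 := by
  have : Nontrivial (AddCircle (1 : ℝ)) := by
    refine ⟨(1 / 2 : ℝ), 0, fun h => ?_⟩
    have := fourier_add_half_inv_index one_ne_zero one_pos (0 : AddCircle (1 : ℝ))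
    simp only [Int.cast_one, div_one, zero_add, h, fourier_eval_zero] at this
    norm_num at this
  have : ({0} : Set (AddCircle (1 : ℝ)))ᶜ ∈ ae haarAddCircle := by
    rw [compl_mem_ae_iff]
    exact measure_singleton 0
  filter_upwards [this] with x hx h
  rw [fourier_one] at h
  exact hx (injective_toCircle one_ne_zero (by ext; simpa using h))

/-- The sequence of Fourier coefficients of a continuous function on the circle, as a continuous
linear map into `ℓ²(ℤ)`. -/
noncomputable def fourierCoeffL2 : C(AddCircle (1 : ℝ), ℂ) →L[ℂ] lp (fun _ : ℤ => ℂ) 2 :=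
  (fourierBasis (T := 1)).repr.toContinuousLinearEquiv.toContinuousLinearMap ∘L
    ContinuousMap.toLp 2 haarAddCircle ℂ

lemma fourierCoeffL2_eq (f : C(AddCircle (1 : ℝ), ℂ)) : fourierCoeffL2 f =
    (fourierBasis (T := 1)).repr (ContinuousMap.toLp 2 haarAddCircle ℂ f) := rfl

lemma fourierCoeffL2_apply (f : C(AddCircle (1 : ℝ), ℂ)) (n : ℤ) :
    fourierCoeffL2 f n = fourierCoeff f n := by
  rw [fourierCoeffL2_eq, fourierBasis_repr, fourierCoeff_toLp]

lemma denseRange_fourierCoeffL2 : DenseRange fourierCoeffL2 :=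
  (fourierBasis (T := 1)).repr.surjective.denseRange.comp
    (ContinuousMap.toLp_denseRange ℂ _ ℂ (by simp)) (fourierBasis (T := 1)).repr.continuous

variable {R : lp (fun _ : ℤ => ℂ) 2 →L[ℂ] lp (fun _ : ℤ => ℂ) 2}

lemma rightShift_pow_fourierCoeffL2
    (hR : ∀ (u : lp (fun _ : ℤ => ℂ) 2) (n : ℤ), R u n = u (n - 1))
    (f : C(AddCircle (1 : ℝ), ℂ)) (n : ℕ) :
    (R ^ n) (fourierCoeffL2 f) = fourierCoeffL2 (fourier 1 ^ n * f) := by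
  induction n with
  | zero => simp
  | succ n ih =>
    rw [pow_succ', mul_apply_eq_comp, ih, pow_succ', mul_assoc]
    ext k
    rw [hR, fourierCoeffL2_apply, fourierCoeffL2_apply, fourierCoeff, fourierCoeff]
    refine integral_congr_ae (Eventually.of_forall fun x => ?_)
    have : -(k - 1) = -k + 1 := by ring
    simp only [this, fourier_add, ContinuousMap.mul_apply, smul_eq_mul]
    ring

lemma fourierCoeffL2_mem_krylov_closure
    (hR : ∀ (u : lp (fun _ : ℤ => ℂ) 2) (n : ℤ), R u n = u (n - 1))
    {G f : C(AddCircle (1 : ℝ), ℂ)}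
    (hf : f ∈ closure ((· * G) ''
      (Algebra.elemental ℂ (fourier (T := (1 : ℝ)) 1) : Set C(AddCircle (1 : ℝ), ℂ)))) :
    fourierCoeffL2 f ∈ (krylov R (fourierCoeffL2 G)).topologicalClosure := by
  set V := (krylov R (fourierCoeffL2 G)).topologicalClosure
  have hV : IsClosed (V : Set (lp (fun _ : ℤ => ℂ) 2)) := Submodule.isClosed_topologicalClosure _
  refine closure_minimal (t := fourierCoeffL2 ⁻¹' V) ?_
    (hV.preimage fourierCoeffL2.continuous) hf
  rintro _ ⟨b, hb, rfl⟩
  refine closure_minimal (t := (fun b => fourierCoeffL2 (b * G)) ⁻¹' V) ?_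
    (hV.preimage (fourierCoeffL2.continuous.comp (by fun_prop))) hb
  intro b hb
  rw [SetLike.mem_coe, Algebra.adjoin_singleton_eq_range_aeval] at hb
  obtain ⟨p, rfl⟩ := hb
  change fourierCoeffL2 (Polynomial.aeval (fourier 1) p * G) ∈ V
  induction p using Polynomial.induction_on' with
  | add p q hp hq =>
    rw [map_add, add_mul, map_add]
    exact V.add_mem hp hq
  | monomial n a =>
    rw [Polynomial.aeval_monomial, ← Algebra.smul_def, smul_mul_assoc, map_smul,
      ← rightShift_pow_fourierCoeffL2 hR]
    exact V.smul_mem _ (Submodule.le_topologicalClosure _ (Submodule.subset_span ⟨n, rfl⟩))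

/-- If `u` is almost everywhere nonzero, then the Fourier coefficients of
`u * expNegWeight z ε` form a cyclic vector for the right shift. -/
lemma krylov_fourierCoeffL2_closure_eq_top
    (hR : ∀ (u : lp (fun _ : ℤ => ℂ) 2) (n : ℤ), R u n = u (n - 1))
    {u : C(AddCircle (1 : ℝ), ℂ)} (hu : ∀ᵐ x ∂haarAddCircle, u x ≠ 0) {ε : ℝ} (hε : 0 < ε) :
    (krylov R (fourierCoeffL2 (u * expNegWeight (fourier 1) ε))).topologicalClosure = ⊤ := by
  set G := u * expNegWeight (fourier 1) ε with hGdef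
  set V := (krylov R (fourierCoeffL2 G)).topologicalClosure
  have hV : IsClosed (V : Set (lp (fun _ : ℤ => ℂ) 2)) := Submodule.isClosed_topologicalClosure _
  have hG : ∀ᵐ x ∂haarAddCircle, G x ≠ 0 := by
    filter_upwards [hu, ae_fourier_one_ne_one] with x hx h1
    rw [hGdef, ContinuousMap.mul_apply, expNegWeight_of_ne_one hε h1]
    exact mul_ne_zero hx (Complex.ofReal_ne_zero.2 (Real.exp_pos _).ne')
  have hzi : (fourier (-1) : C(AddCircle (1 : ℝ), ℂ)) * fourier 1 = 1 := by
    rw [← fourier_add_eq_mul]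
    ext x
    simp
  set W := closure ((· * G) ''
      (Algebra.elemental ℂ (fourier (T := (1 : ℝ)) 1) : Set C(AddCircle (1 : ℝ), ℂ)))
  have hpow : ∀ n : ℤ, fourier n * G ∈ W := by
    intro n
    induction n with
    | zero =>
      refine subset_closure ⟨1, one_mem _, ?_⟩
      ext x
      simp
    | succ n ih =>
      rw [add_comm, fourier_add_eq_mul, mul_assoc]
      refine map_mem_closure (by fun_prop : Continuous fun f => fourier 1 * f) ih ?_
      rintro _ ⟨b, hb, rfl⟩
      exact ⟨fourier 1 * b, mul_mem (Algebra.elemental.self_mem ℂ _) hb, mul_assoc _ _ _⟩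
    | pred n ih =>
      rw [sub_eq_add_neg, add_comm, fourier_add_eq_mul, mul_assoc]
      exact inv_mul_mem_closure_elemental_mul (fun x => Circle.norm_coe _) hzi hε u ih
  have hmul : ∀ f : C(AddCircle (1 : ℝ), ℂ), fourierCoeffL2 (f * G) ∈ V := by
    intro f
    have hf : f ∈ (Submodule.span ℂ (Set.range (@fourier 1))).topologicalClosure := by
      rw [span_fourier_closure_eq_top]
      trivial
    refine closure_minimal (t := (fun f => fourierCoeffL2 (f * G)) ⁻¹' V) (fun f hf => ?_)
      (hV.preimage (fourierCoeffL2.continuous.comp (by fun_prop))) hf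
    change fourierCoeffL2 (f * G) ∈ V
    induction hf using Submodule.span_induction with
    | mem f hf =>
      obtain ⟨n, rfl⟩ := hf
      exact fourierCoeffL2_mem_krylov_closure hR (hpow n)
    | zero => simp
    | add f g _ _ hf hg =>
      rw [add_mul, map_add]
      exact V.add_mem hf hg
    | smul a f _ hf =>
      rw [smul_mul_assoc, map_smul]
      exact V.smul_mem a hf
  rw [Submodule.topologicalClosure_eq_top_iff, Submodule.eq_bot_iff]
  intro v hv
  rw [← Submodule.orthogonal_closure] at hv
  obtain ⟨w, rfl⟩ := (fourierBasis (T := 1)).repr.surjective v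
  have hw : w = 0 := eq_zero_of_inner_toLp_mul_eq_zero hG fun f => by
    rw [← (fourierBasis (T := 1)).repr.inner_map_map]
    exact hv _ (hmul f)
  rw [hw, map_zero]

end Circle

/-- Let `R` be the right shift on `ℓ²(ℤ)`, i.e. `(R f) n = f (n - 1)`. Then the set of
cyclic vectors of `R`, i.e. of those `g` such that the closure of
`K(R,g) = span {Rⁿ g : n ≥ 0}` is the whole of `ℓ²(ℤ)`, is dense in `ℓ²(ℤ)`. -/
theorem rightShift_cyclicVectors_dense
    (R : lp (fun _ : ℤ => ℂ) 2 →L[ℂ] lp (fun _ : ℤ => ℂ) 2)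
    (hR : ∀ (u : lp (fun _ : ℤ => ℂ) 2) (n : ℤ), R u n = u (n - 1)) :
    Dense {g : lp (fun _ : ℤ => ℂ) 2 | (krylov R g).topologicalClosure = ⊤} := by
  refine Dense.of_closure (((denseRange_fourierCoeffL2.dense_image fourierCoeffL2.continuous
    (dense_ae_ne_zero (μ := haarAddCircle)))).mono ?_)
  rintro _ ⟨u, hu, rfl⟩
  have hlim : Tendsto (fun n : ℕ => fourierCoeffL2
      (u * expNegWeight (fourier 1) (1 / ((n : ℝ) + 1)))) atTop (𝓝 (fourierCoeffL2 u)) := by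
    refine ((fourierBasis (T := 1)).repr.continuous.tendsto _).comp
      (tendsto_toLp_two_of_ae (C := ‖u‖) (fun n x => ?_) ?_)
    · rw [ContinuousMap.mul_apply, norm_mul]
      exact (mul_le_of_le_one_right (norm_nonneg _)
        (norm_expNegWeight_le_one _ (by positivity) x)).trans (u.norm_coe_le_norm x)
    · filter_upwards [ae_fourier_one_ne_one] with x hx
      have h : Tendsto (fun n : ℕ => (u x * (Real.exp
          (-(1 / ((n : ℝ) + 1) / ‖1 - fourier 1 x‖ ^ 2)) : ℝ) : ℂ)) atTop (𝓝 (u x * (1 : ℝ))) := by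
        refine tendsto_const_nhds.mul ((Complex.continuous_ofReal.tendsto _).comp ?_)
        have := ((tendsto_one_div_add_atTop_nhds_zero_nat (𝕜 := ℝ)).div_const
          (‖1 - fourier 1 x‖ ^ 2)).neg.rexp
        simpa using this
      rw [Complex.ofReal_one, mul_one] at h
      refine h.congr fun n => ?_
      rw [ContinuousMap.mul_apply, expNegWeight_of_ne_one (by positivity) hx]
  exact mem_closure_of_tendsto hlim
    (Eventually.of_forall fun n => krylov_fourierCoeffL2_closure_eq_top hR hu (by positivity))
end

section
/- Let A be a densely defined closed operator on a complex Hilbert space H, and let g ∈ ran A ∩ dom A*. Then there exists u ∈ dom(A* A) with A u = g, so that A* g = A* A u belongs to ran(A* A). If moreover A* g is a quasi-analytic vector for the self-adjoint operator A* A (i.e., A* g ∈ dom((A*A)^n) for all n and ∑_{n≥1} ‖(A*A)^n A* g‖^{-1/n} = +∞), then there exists a unique f in the closure of K(A*A, A*g) with f ∈ dom(A*A) and A* A f = A* g, and this f moreover satisfies A f = g. -/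
section Residual

open Polynomial Filter Topology

theorem abs_eval_T_le_three_mul_abs_pow {y : ℝ} (hy : 1 ≤ |y|) (k : ℕ) :
    |(Chebyshev.T ℝ k).eval y| ≤ (3 * |y|) ^ k := by
  induction k using Nat.twoStepInduction with
  | zero => simp
  | one => simp; linarith [abs_nonneg y]
  | more n h₀ h₁ =>
    have h : (Chebyshev.T ℝ ((n + 2 : ℕ) : ℤ)).eval y =
        2 * y * (Chebyshev.T ℝ ((n + 1 : ℕ) : ℤ)).eval y - (Chebyshev.T ℝ (n : ℤ)).eval y := by
      push_cast
      rw [Chebyshev.T_add_two]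
      simp
    rw [h]
    have h₂ : (0 : ℝ) ≤ (3 * |y|) ^ n := by positivity
    calc _ ≤ |2 * y * (Chebyshev.T ℝ ((n + 1 : ℕ) : ℤ)).eval y| +
          |(Chebyshev.T ℝ (n : ℤ)).eval y| := abs_sub _ _
      _ ≤ 2 * |y| * (3 * |y|) ^ (n + 1) + (3 * |y|) ^ n := by
          rw [abs_mul, abs_mul, abs_two]
          gcongr
      _ = (2 * |y| * (3 * |y|) + 1) * (3 * |y|) ^ n := by ring
      _ ≤ (3 * |y|) ^ 2 * (3 * |y|) ^ n := by
          gcongr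
          nlinarith
      _ = _ := by ring

/-- The Dirichlet kernel `1 + 2 ∑_{k=1}^m T_k` as a polynomial in `cos θ`. -/
noncomputable def dirichletPoly (m : ℕ) : ℝ[X] :=
  1 + 2 * ∑ k ∈ Finset.range m, Chebyshev.T ℝ ((k + 1 : ℕ) : ℤ)

theorem natDegree_dirichletPoly_le (m : ℕ) : (dirichletPoly m).natDegree ≤ m := by
  have h : (∑ k ∈ Finset.range m, Chebyshev.T ℝ ((k + 1 : ℕ) : ℤ)).natDegree ≤ m := by
    refine natDegree_sum_le_of_forall_le _ _ fun k hk => ?_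
    rw [Chebyshev.natDegree_T]
    have := Finset.mem_range.1 hk
    omega
  refine natDegree_add_le_of_degree_le (by simp) ?_
  refine natDegree_mul_le.trans ?_
  have : (2 : ℝ[X]).natDegree = 0 := natDegree_ofNat 2
  omega

theorem eval_one_dirichletPoly (m : ℕ) : (dirichletPoly m).eval 1 = 2 * m + 1 := by
  simp [dirichletPoly, eval_finsetSum, Chebyshev.T_eval_one]; ring

theorem abs_eval_dirichletPoly_le {m : ℕ} {y B : ℝ} (hB : 1 ≤ B)
    (h : ∀ k ≤ m, |(Chebyshev.T ℝ (k : ℤ)).eval y| ≤ B) :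
    |(dirichletPoly m).eval y| ≤ (2 * m + 1) * B := by
  have h₁ : |∑ k ∈ Finset.range m, (Chebyshev.T ℝ ((k + 1 : ℕ) : ℤ)).eval y| ≤ m * B := by
    refine (Finset.abs_sum_le_sum_abs _ _).trans ?_
    refine (Finset.sum_le_card_nsmul _ _ B fun k hk => h _ ?_).trans (by simp)
    have := Finset.mem_range.1 hk
    omega
  have h₂ : (dirichletPoly m).eval y =
      1 + 2 * ∑ k ∈ Finset.range m, (Chebyshev.T ℝ ((k + 1 : ℕ) : ℤ)).eval y := by
    simp [dirichletPoly, eval_finsetSum]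
  rw [h₂]
  rw [abs_le] at *
  constructor <;> linarith

theorem one_sub_mul_eval_dirichletPoly (m : ℕ) (y : ℝ) :
    (1 - y) * (dirichletPoly m).eval y =
      (Chebyshev.T ℝ (m : ℤ)).eval y - (Chebyshev.T ℝ ((m + 1 : ℕ) : ℤ)).eval y := by
  induction m with
  | zero => simp [dirichletPoly]
  | succ n ih =>
    have h : (dirichletPoly (n + 1)).eval y =
        (dirichletPoly n).eval y + 2 * (Chebyshev.T ℝ ((n + 1 : ℕ) : ℤ)).eval y := by
      simp [dirichletPoly, eval_finsetSum, Finset.sum_range_succ]; ring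
    have h' : (Chebyshev.T ℝ ((n + 1 + 1 : ℕ) : ℤ)).eval y =
        2 * y * (Chebyshev.T ℝ ((n + 1 : ℕ) : ℤ)).eval y - (Chebyshev.T ℝ (n : ℤ)).eval y := by
      simp [add_assoc, one_add_one_eq_two]
    rw [h, h', mul_add, ih]
    ring

theorem one_sub_mul_sq_eval_dirichletPoly_le (m : ℕ) {y : ℝ} (hy : |y| ≤ 1) :
    (1 - y) * (dirichletPoly m).eval y ^ 2 ≤ 2 := by
  obtain ⟨hy₁, hy₂⟩ := abs_le.1 hy
  rcases hy₂.eq_or_lt with rfl | hlt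
  · simp
  obtain ⟨θ, rfl⟩ : ∃ θ, Real.cos θ = y := ⟨_, Real.cos_arccos hy₁ hy₂⟩
  have h := one_sub_mul_eval_dirichletPoly m (Real.cos θ)
  rw [Chebyshev.T_real_cos, Chebyshev.T_real_cos, Real.cos_sub_cos] at h
  have hs : Real.sin (((m : ℤ) * θ - ((m + 1 : ℕ) : ℤ) * θ) / 2) ^ 2 = (1 - Real.cos θ) / 2 := by
    have : ((m : ℤ) * θ - ((m + 1 : ℕ) : ℤ) * θ) / 2 = - (θ / 2) := by push_cast; ring
    rw [this, Real.sin_sq_eq_half_sub]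
    rw [show 2 * -(θ / 2) = -θ by ring, Real.cos_neg]
    ring
  have hpos : 0 < 1 - Real.cos θ := by linarith
  refine le_of_mul_le_mul_left ?_ hpos
  calc _ = ((1 - Real.cos θ) * (dirichletPoly m).eval (Real.cos θ)) ^ 2 := by ring
    _ = 4 * Real.sin (((m : ℤ) * θ + ((m + 1 : ℕ) : ℤ) * θ) / 2) ^ 2 *
        ((1 - Real.cos θ) / 2) := by rw [h, ← hs]; ring
    _ ≤ 4 * 1 * ((1 - Real.cos θ) / 2) := by
        gcongr
        exact Real.sin_sq_le_one _
    _ = _ := by ring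

/-- Residual polynomials, normalised at `0`, which are bounded on `[0, L]`, small there after
multiplication by the variable, and of controlled growth on `[L, ∞)`. -/
theorem exists_residual_polynomial (m : ℕ) {L : ℝ} (hL : 0 < L) :
    ∃ q : ℝ[X], q.natDegree ≤ m ∧ q.coeff 0 = 1 ∧
      (∀ t, 0 ≤ t → q.eval t ^ 2 ≤ 1 + (6 / L) ^ (2 * m) / L ^ 2 * t ^ (2 * (m + 1))) ∧
      (∀ t, 0 ≤ t → t * q.eval t ^ 2 ≤
        L / (2 * m + 1) ^ 2 + (6 / L) ^ (2 * m) / L * t ^ (2 * (m + 1))) := by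
  have hm : (0 : ℝ) < 2 * m + 1 := by positivity
  set q : ℝ[X] := C ((2 * m + 1 : ℝ)⁻¹) * (dirichletPoly m).comp (1 - C (2 / L) * X) with hq
  have heval (t : ℝ) : q.eval t = (2 * m + 1 : ℝ)⁻¹ * (dirichletPoly m).eval (1 - 2 / L * t) := by
    simp [hq]
  have hlarge (t : ℝ) (ht : L ≤ t) : q.eval t ^ 2 ≤ (6 / L) ^ (2 * m) * t ^ (2 * m) := by
    have ht' : 1 ≤ t / L := (one_le_div hL).2 ht
    have hy : 1 - 2 / L * t = -(2 * (t / L) - 1) := by ring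
    have habs : |1 - 2 / L * t| = 2 * (t / L) - 1 := by
      rw [hy, abs_neg, abs_of_nonneg (by linarith)]
    have hB : |(dirichletPoly m).eval (1 - 2 / L * t)| ≤ (2 * m + 1) * (6 * (t / L)) ^ m := by
      refine abs_eval_dirichletPoly_le (one_le_pow₀ (by linarith)) fun k hk => ?_
      refine (abs_eval_T_le_three_mul_abs_pow (by rw [habs]; linarith) k).trans ?_
      rw [habs]
      calc _ ≤ (6 * (t / L)) ^ k := pow_le_pow_left₀ (by linarith) (by linarith) _
        _ ≤ _ := pow_le_pow_right₀ (by linarith) hk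
    have : |q.eval t| ≤ (6 * (t / L)) ^ m := by
      rw [heval, abs_mul, abs_of_pos (inv_pos.2 hm)]
      exact (inv_mul_le_iff₀ hm).2 hB
    calc q.eval t ^ 2 = |q.eval t| ^ 2 := (sq_abs _).symm
      _ ≤ ((6 * (t / L)) ^ m) ^ 2 := by gcongr
      _ = (6 / L * t) ^ (2 * m) := by rw [← pow_mul]; ring_nf
      _ = _ := mul_pow _ _ _
  have hy (t : ℝ) (ht : 0 ≤ t) (htL : t ≤ L) : |1 - 2 / L * t| ≤ 1 := by
    have h₁ : t / L ≤ 1 := (div_le_one hL).2 htL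
    have h₂ : 0 ≤ t / L := by positivity
    have : 2 / L * t = 2 * (t / L) := by ring
    rw [abs_le]
    constructor <;> linarith
  refine ⟨q, ?_, ?_, fun t ht => ?_, fun t ht => ?_⟩
  · refine (natDegree_C_mul_le _ _).trans (natDegree_comp_le.trans ?_)
    have h : (1 - C (2 / L) * X : ℝ[X]).natDegree ≤ 1 := by compute_degree
    calc _ ≤ m * 1 := Nat.mul_le_mul (natDegree_dirichletPoly_le m) h
      _ = m := mul_one m
  · rw [coeff_zero_eq_eval_zero, heval]
    simp [eval_one_dirichletPoly, hm.ne']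
  · rcases le_total t L with htL | htL
    · have hB : |(dirichletPoly m).eval (1 - 2 / L * t)| ≤ (2 * m + 1) * 1 :=
        abs_eval_dirichletPoly_le le_rfl fun k _ =>
          Chebyshev.abs_eval_T_real_le_one k (hy t ht htL)
      have h₁ : |q.eval t| ≤ 1 := by
        rw [heval, abs_mul, abs_of_pos (inv_pos.2 hm)]
        exact (inv_mul_le_iff₀ hm).2 hB
      have h₂ : 0 ≤ (6 / L) ^ (2 * m) / L ^ 2 * t ^ (2 * (m + 1)) := by positivity
      have h₃ : q.eval t ^ 2 ≤ 1 := (sq_le_one_iff_abs_le_one _).2 h₁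
      linarith
    · have h₁ : 1 ≤ (t / L) ^ 2 := one_le_pow₀ ((one_le_div hL).2 htL)
      calc q.eval t ^ 2 ≤ (6 / L) ^ (2 * m) * t ^ (2 * m) := hlarge t htL
        _ ≤ (6 / L) ^ (2 * m) * t ^ (2 * m) * (t / L) ^ 2 := le_mul_of_one_le_right (by positivity) h₁
        _ = (6 / L) ^ (2 * m) / L ^ 2 * t ^ (2 * (m + 1)) := by ring
        _ ≤ _ := by linarith
  · rcases le_total t L with htL | htL
    · have h₁ := one_sub_mul_sq_eval_dirichletPoly_le m (hy t ht htL)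
      have h₂ : 0 ≤ (6 / L) ^ (2 * m) / L * t ^ (2 * (m + 1)) := by positivity
      have h₃ : t * q.eval t ^ 2 ≤ L / (2 * m + 1) ^ 2 := by
        rw [heval]
        calc _ = L / (2 * m + 1) ^ 2 / 2 * ((1 - (1 - 2 / L * t)) *
              (dirichletPoly m).eval (1 - 2 / L * t) ^ 2) := by
              generalize (dirichletPoly m).eval (1 - 2 / L * t) = z
              field_simp
              ring
          _ ≤ L / (2 * m + 1) ^ 2 / 2 * 2 := by gcongr
          _ = _ := by ring
      linarith
    · have h₁ : 1 ≤ t / L := (one_le_div hL).2 htL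
      have h₂ : 0 ≤ L / (2 * m + 1 : ℝ) ^ 2 := by positivity
      calc t * q.eval t ^ 2 ≤ t * ((6 / L) ^ (2 * m) * t ^ (2 * m)) := by
            gcongr
            exact hlarge t htL
        _ ≤ t * ((6 / L) ^ (2 * m) * t ^ (2 * m)) * (t / L) :=
            le_mul_of_one_le_right (by positivity) h₁
        _ = (6 / L) ^ (2 * m) / L * t ^ (2 * (m + 1)) := by ring
        _ ≤ _ := by linarith

theorem OrthonormalBasis.norm_sq_eq_sum_repr {ι E : Type*} [Fintype ι] [NormedAddCommGroup E]
    [InnerProductSpace ℂ E] (b : OrthonormalBasis ι ℂ E) (x : E) :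
    ‖x‖ ^ 2 = ∑ i, ‖b.repr x i‖ ^ 2 := by
  rw [← b.repr.norm_map x, EuclideanSpace.norm_sq_eq]

section
variable {E F : Type*} [NormedAddCommGroup E] [InnerProductSpace ℂ E] [FiniteDimensional ℂ E]

theorem LinearMap.IsSymmetric.repr_aeval {J : E →ₗ[ℂ] E} (hJ : J.IsSymmetric)
    {n : ℕ} (hn : Module.finrank ℂ E = n) (p : ℝ[X]) (u : E) (i : Fin n) :
    (hJ.eigenvectorBasis hn).repr (aeval J p u) i =
      ((p.eval (hJ.eigenvalues hn i) : ℝ) : ℂ) * (hJ.eigenvectorBasis hn).repr u i := by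
  induction p using Polynomial.induction_on' generalizing u with
  | add p q hp hq => simp [hp, hq, add_mul]
  | monomial k a =>
    simp only [aeval_monomial, Module.End.mul_apply, eval_monomial]
    have h (x : E) : (hJ.eigenvectorBasis hn).repr ((J ^ k) x) i =
        (hJ.eigenvalues hn i : ℂ) ^ k * (hJ.eigenvectorBasis hn).repr x i := by
      induction k with
      | zero => simp
      | succ k ih =>
        rw [pow_succ', Module.End.mul_apply, hJ.eigenvectorBasis_apply_self_apply, ih]
        simp; ring
    rw [Algebra.algebraMap_eq_smul_one, LinearMap.smul_apply, Module.End.one_apply,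
      RCLike.real_smul_eq_coe_smul (K := ℂ), map_smul]
    simp [h, mul_assoc]

variable [NormedAddCommGroup F] [InnerProductSpace ℂ F]

/-- Functional calculus estimates for the Gram operator of `a`. -/
theorem norm_sq_aeval_le {J : E →ₗ[ℂ] E} {a : E →ₗ[ℂ] F}
    (hJa : ∀ x y, inner ℂ (J x) y = inner ℂ (a x) (a y)) (p : ℝ[X]) (u : E) (N : ℕ)
    {c₀ c₁ : ℝ} :
    ((∀ t, 0 ≤ t → p.eval t ^ 2 ≤ c₀ + c₁ * t ^ (2 * N)) →
      ‖aeval J p u‖ ^ 2 ≤ c₀ * ‖u‖ ^ 2 + c₁ * ‖(J ^ N) u‖ ^ 2) ∧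
    ((∀ t, 0 ≤ t → t * p.eval t ^ 2 ≤ c₀ + c₁ * t ^ (2 * N)) →
      ‖a (aeval J p u)‖ ^ 2 ≤
        c₀ * ‖u‖ ^ 2 + c₁ * ‖(J ^ N) u‖ ^ 2) := by
  have hJ : J.IsSymmetric := fun x y => by
    rw [hJa, ← inner_conj_symm x, hJa, inner_conj_symm]
  set b := hJ.eigenvectorBasis rfl with hb
  set l := hJ.eigenvalues rfl with hl
  have hrepr (p : ℝ[X]) (i) : ‖b.repr (aeval J p u) i‖ ^ 2 =
      p.eval (l i) ^ 2 * ‖b.repr u i‖ ^ 2 := by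
    rw [hJ.repr_aeval, norm_mul, mul_pow, Complex.norm_real, Real.norm_eq_abs, sq_abs]
  have hpow (i) : ‖b.repr ((J ^ N) u) i‖ ^ 2 = l i ^ (2 * N) * ‖b.repr u i‖ ^ 2 := by
    have := hrepr (X ^ N) i
    simpa [← pow_mul, mul_comm N 2] using this
  have hpos (i) : 0 ≤ l i := by
    have h := hJa (b i) (b i)
    rw [hb, hJ.apply_eigenvectorBasis, inner_smul_left, inner_self_eq_norm_sq_to_K,
      inner_self_eq_norm_sq_to_K, ← hb, b.norm_eq_one] at h
    simp only [Complex.coe_algebraMap, Complex.ofReal_one, one_pow, mul_one] at h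
    have h' : ((l i : ℝ) : ℂ) = ((‖a (b i)‖ ^ 2 : ℝ) : ℂ) := by simpa using h
    rw [Complex.ofReal_inj.1 h']
    positivity
  have ha (x : E) : ‖a x‖ ^ 2 = ∑ i, l i * ‖b.repr x i‖ ^ 2 := by
    have h := hJa x x
    rw [inner_self_eq_norm_sq_to_K, ← b.repr.inner_map_map, PiLp.inner_apply] at h
    have h' : (((‖a x‖ ^ 2 : ℝ)) : ℂ) = ((∑ i, l i * ‖b.repr x i‖ ^ 2 : ℝ) : ℂ) := by
      rw [Complex.ofReal_pow]
      refine h.symm.trans ?_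
      rw [Complex.ofReal_sum]
      refine Finset.sum_congr rfl fun i _ => ?_
      rw [hb, hJ.eigenvectorBasis_apply_self_apply, ← hb]
      rw [← smul_eq_mul, inner_smul_left, inner_self_eq_norm_sq_to_K]
      simp [hl]
    exact Complex.ofReal_inj.1 h'
  have hR : c₀ * ‖u‖ ^ 2 + c₁ * ‖(J ^ N) u‖ ^ 2 =
      ∑ i, (c₀ + c₁ * l i ^ (2 * N)) * ‖b.repr u i‖ ^ 2 := by
    rw [b.norm_sq_eq_sum_repr u, b.norm_sq_eq_sum_repr ((J ^ N) u), Finset.mul_sum,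
      Finset.mul_sum, ← Finset.sum_add_distrib]
    refine Finset.sum_congr rfl fun i _ => ?_
    rw [hpow]
    ring
  refine ⟨fun h => ?_, fun h => ?_⟩
  · rw [hR, b.norm_sq_eq_sum_repr]
    refine Finset.sum_le_sum fun i _ => ?_
    rw [hrepr]
    exact mul_le_mul_of_nonneg_right (h _ (hpos i)) (sq_nonneg _)
  · rw [hR, ha]
    refine Finset.sum_le_sum fun i _ => ?_
    rw [hrepr, ← mul_assoc]
    exact mul_le_mul_of_nonneg_right (h _ (hpos i)) (sq_nonneg _)
end

open LinearPMap in
/-- Approximate solutions of `A x = A (s 0)` in the Krylov space, for an orbit `s` of `A*A`. -/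
theorem exists_krylov_residual {H : Type*} [NormedAddCommGroup H] [InnerProductSpace ℂ H]
    [CompleteSpace H] (A : H →ₗ.[ℂ] H) (hdense : Dense (A.domain : Set H)) (s : ℕ → H)
    (hs : ∀ n : ℕ, ∃ (h₁ : s n ∈ A.domain) (h₂ : A ⟨s n, h₁⟩ ∈ A.adjoint.domain),
      A.adjoint ⟨A ⟨s n, h₁⟩, h₂⟩ = s (n + 1)) (m : ℕ) {L : ℝ} (hL : 0 < L) :
    ∃ e : A.domain, s 0 - e ∈ Submodule.span ℂ (Set.range fun n => s (n + 1)) ∧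
      ‖(e : H)‖ ^ 2 ≤ 1 * ‖s 0‖ ^ 2 + (6 / L) ^ (2 * m) / L ^ 2 * ‖s (m + 1)‖ ^ 2 ∧
      ‖A e‖ ^ 2 ≤ L / (2 * m + 1) ^ 2 * ‖s 0‖ ^ 2 + (6 / L) ^ (2 * m) / L * ‖s (m + 1)‖ ^ 2 := by
  obtain ⟨q, hdeg, hq0, hq₁, hq₂⟩ := exists_residual_polynomial m hL
  choose h₁ h₂ h₃ using hs
  set E : Submodule ℂ H := Submodule.span ℂ (s '' Finset.range (m + 2)) with hE
  have : FiniteDimensional ℂ E :=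
    FiniteDimensional.span_of_finite ℂ ((Finset.finite_toSet _).image s)
  have hmem {k : ℕ} (hk : k ≤ m + 1) : s k ∈ E :=
    Submodule.subset_span ⟨k, by simp; omega, rfl⟩
  have hle : E ≤ A.domain := by
    rw [hE, Submodule.span_le]
    rintro _ ⟨k, -, rfl⟩
    exact h₁ k
  set a : E →ₗ[ℂ] H := A.toFun ∘ₗ Submodule.inclusion hle
  set J : E →ₗ[ℂ] E :=
    ((a.toContinuousLinearMap).adjoint ∘L a.toContinuousLinearMap).toLinearMap with hJ
  have hJa (x y : E) : inner ℂ (J x) y = inner ℂ (a x) (a y) := by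
    simp [hJ, ContinuousLinearMap.adjoint_inner_left]
  have hstep {k : ℕ} (hk : k + 1 ≤ m + 1) :
      J ⟨s k, hmem (by omega)⟩ = ⟨s (k + 1), hmem hk⟩ := by
    refine ext_inner_right ℂ fun y => ?_
    rw [hJa]
    change _ = inner ℂ (s (k + 1)) (y : H)
    rw [← h₃ k]
    exact (adjoint_isFormalAdjoint hdense ⟨_, h₂ k⟩ ⟨(y : H), hle y.2⟩).symm
  set u : E := ⟨s 0, hmem (by omega)⟩ with hu
  have hpow {k : ℕ} (hk : k ≤ m + 1) : (J ^ k) u = ⟨s k, hmem hk⟩ := by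
    induction k with
    | zero => simp [hu]
    | succ k ih => rw [pow_succ', Module.End.mul_apply, ih (by omega), hstep hk]
  have hspec := (norm_sq_aeval_le hJa q u (m + 1)).1 hq₁
  have hspec' := (norm_sq_aeval_le hJa q u (m + 1)).2 hq₂
  rw [hpow le_rfl] at hspec hspec'
  refine ⟨⟨_, hle (aeval J q u).2⟩, ?_, hspec, hspec'⟩
  have hsum : (aeval J q u : H) = ∑ k ∈ Finset.range (m + 1), q.coeff k • s k := by
    rw [aeval_eq_sum_range' (Nat.lt_succ_of_le hdeg), LinearMap.sum_apply, Submodule.coe_sum]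
    refine Finset.sum_congr rfl fun k hk => ?_
    rw [LinearMap.smul_apply, hpow (Finset.mem_range.1 hk).le]
    rfl
  rw [hsum, Finset.sum_range_succ', hq0, one_smul, sub_add_cancel_right]
  refine neg_mem (Submodule.sum_mem _ fun k _ => ?_)
  rw [RCLike.real_smul_eq_coe_smul (K := ℂ)]
  exact Submodule.smul_mem _ _ (Submodule.subset_span ⟨k, rfl⟩)

theorem frequently_le_of_not_summable {M : ℕ → ℝ} (hM : ∀ n, 0 ≤ M n)
    (h : ¬ Summable fun n : ℕ => M n ^ (-(1 : ℝ) / ((n : ℝ) + 1))) :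
    ∃ᶠ n : ℕ in atTop, M n ≤ (((n : ℝ) + 1) ^ (3 / 2 : ℝ)) ^ (n + 1) := by
  intro hlt
  refine h ?_
  have hsum : Summable fun n : ℕ => ((n : ℝ) + 1) ^ (-(3 / 2) : ℝ) := by
    have := (summable_nat_add_iff 1).2 (Real.summable_nat_rpow.2 (by norm_num : (-(3 / 2) : ℝ) < -1))
    simpa using this
  refine hsum.of_norm_bounded_eventually_nat ?_
  filter_upwards [hlt] with n hn
  rw [not_le] at hn
  have hn0 : (0 : ℝ) < (n : ℝ) + 1 := by positivity
  rw [Real.norm_of_nonneg (Real.rpow_nonneg (hM n) _)]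
  calc _ ≤ ((((n : ℝ) + 1) ^ (3 / 2 : ℝ)) ^ (n + 1)) ^ (-(1 : ℝ) / ((n : ℝ) + 1)) := by
        refine Real.rpow_le_rpow_of_nonpos (by positivity) hn.le ?_
        exact div_nonpos_of_nonpos_of_nonneg (by norm_num) hn0.le
    _ = _ := by
        rw [← Real.rpow_natCast, ← Real.rpow_mul hn0.le, ← Real.rpow_mul hn0.le]
        congr 1
        push_cast
        field_simp

theorem exists_bounded_residual {H : Type*} [NormedAddCommGroup H] [InnerProductSpace ℂ H]
    [CompleteSpace H] (A : H →ₗ.[ℂ] H) (hdense : Dense (A.domain : Set H)) (s : ℕ → H)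
    (hs : ∀ n : ℕ, ∃ (h₁ : s n ∈ A.domain) (h₂ : A ⟨s n, h₁⟩ ∈ A.adjoint.domain),
      A.adjoint ⟨A ⟨s n, h₁⟩, h₂⟩ = s (n + 1))
    (hqa : ¬ Summable fun n : ℕ => ‖s (n + 2)‖ ^ (-(1 : ℝ) / ((n : ℝ) + 1)))
    {ε : ℝ} (hε : 0 < ε) :
    ∃ e : A.domain, s 0 - e ∈ Submodule.span ℂ (Set.range fun n => s (n + 1)) ∧
      ‖(e : H)‖ ^ 2 ≤ ‖s 0‖ ^ 2 + 1 ∧ ‖A e‖ ^ 2 ≤ ε := by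
  have hfreq := frequently_le_of_not_summable (fun n => norm_nonneg (s (n + 2))) hqa
  have hlim : Tendsto (fun n : ℕ => 3 * ‖s 0‖ ^ 2 * ((n : ℝ) + 1) ^ (-(1 / 2) : ℝ) +
      (1 / 4 : ℝ) ^ (n + 1)) atTop (𝓝 0) := by
    have h₁ : Tendsto (fun n : ℕ => (n : ℝ) + 1) atTop atTop :=
      tendsto_natCast_atTop_atTop.atTop_add tendsto_const_nhds
    have h₂ := (tendsto_rpow_neg_atTop (by norm_num : (0 : ℝ) < 1 / 2)).comp h₁
    have h₃ : Tendsto (fun n : ℕ => (1 / 4 : ℝ) ^ (n + 1)) atTop (𝓝 0) :=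
      (tendsto_add_atTop_iff_nat 1).2
        (tendsto_pow_atTop_nhds_zero_of_lt_one (by norm_num) (by norm_num))
    simpa using (h₂.const_mul (3 * ‖s 0‖ ^ 2)).add h₃
  obtain ⟨n, hn, hlt⟩ := (hfreq.and_eventually (hlim.eventually_lt_const hε)).exists
  set r : ℝ := ((n : ℝ) + 1) ^ (3 / 2 : ℝ) with hr
  have hr1 : 1 ≤ r := Real.one_le_rpow (by linarith [n.cast_nonneg (α := ℝ)]) (by norm_num)
  have hr0 : 0 < r := by linarith
  obtain ⟨e, he, he₁, he₂⟩ := exists_krylov_residual A hdense s hs (n + 1)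
    (by positivity : 0 < 12 * r)
  have hsmall : (6 / (12 * r)) ^ (2 * (n + 1)) * ‖s (n + 1 + 1)‖ ^ 2 ≤ (1 / 4) ^ (n + 1) := by
    calc _ ≤ (6 / (12 * r)) ^ (2 * (n + 1)) * (r ^ (n + 1)) ^ 2 := by gcongr
      _ = ((6 / (12 * r)) ^ 2 * r ^ 2) ^ (n + 1) := by
          rw [mul_pow, ← pow_mul, ← pow_mul, ← pow_mul, mul_comm (n + 1) 2]
      _ = _ := by congr 1; field_simp; norm_num
  have hquarter : (1 / 4 : ℝ) ^ (n + 1) ≤ 1 := pow_le_one₀ (by norm_num) (by norm_num)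
  refine ⟨e, he, he₁.trans ?_, he₂.trans (le_trans ?_ hlt.le)⟩
  · have : (6 / (12 * r)) ^ (2 * (n + 1)) / (12 * r) ^ 2 * ‖s (n + 1 + 1)‖ ^ 2 ≤
        (6 / (12 * r)) ^ (2 * (n + 1)) * ‖s (n + 1 + 1)‖ ^ 2 := by
      gcongr
      exact div_le_self (by positivity) (one_le_pow₀ (by linarith))
    linarith
  · have h₁ : (6 / (12 * r)) ^ (2 * (n + 1)) / (12 * r) * ‖s (n + 1 + 1)‖ ^ 2 ≤
        (6 / (12 * r)) ^ (2 * (n + 1)) * ‖s (n + 1 + 1)‖ ^ 2 := by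
      gcongr
      exact div_le_self (by positivity) (by linarith)
    have hn0 : (0 : ℝ) < (n : ℝ) + 1 := by positivity
    have hr' : r = ((n : ℝ) + 1) ^ 2 * ((n : ℝ) + 1) ^ (-(1 / 2) : ℝ) := by
      rw [hr, ← Real.rpow_natCast, ← Real.rpow_add hn0]
      norm_num
    have h₂ : 12 * r / (2 * ((n + 1 : ℕ) : ℝ) + 1) ^ 2 ≤ 3 * ((n : ℝ) + 1) ^ (-(1 / 2) : ℝ) := by
      rw [div_le_iff₀ (by positivity), hr']
      push_cast
      have : (0 : ℝ) ≤ ((n : ℝ) + 1) ^ (-(1 / 2) : ℝ) := by positivity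
      generalize ((n : ℝ) + 1) ^ (-(1 / 2) : ℝ) = z at *
      nlinarith [mul_nonneg this hn0.le]
    have h₃ := mul_le_mul_of_nonneg_right h₂ (sq_nonneg ‖s 0‖)
    linarith

/-- For closed `A`, the orthogonal complement of the range of `A*` is the kernel of `A`. -/
theorem LinearPMap.exists_apply_eq_zero_of_inner_adjoint_eq_zero {H : Type*}
    [NormedAddCommGroup H] [InnerProductSpace ℂ H] [CompleteSpace H] (A : H →ₗ.[ℂ] H)
    (hdense : Dense (A.domain : Set H)) (hclosed : A.IsClosed) {x : H}
    (hx : ∀ y : A.adjoint.domain, inner ℂ (A.adjoint y) x = 0) :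
    (x, (0 : H)) ∈ A.graph := by
  set G : Submodule ℂ (WithLp 2 (H × H)) :=
    A.graph.comap (WithLp.linearEquiv 2 ℂ (H × H)).toLinearMap
  have hGc : _root_.IsClosed (G : Set (WithLp 2 (H × H))) :=
    hclosed.preimage (WithLp.prod_continuous_ofLp 2 H H)
  have hmem : WithLp.toLp 2 (x, (0 : H)) ∈ Gᗮᗮ := by
    rw [Submodule.mem_orthogonal]
    intro w hw
    rw [Submodule.mem_orthogonal'] at hw
    have hw' (z : A.domain) : inner ℂ w.fst (z : H) + inner ℂ w.snd (A z) = 0 := by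
      have := hw (WithLp.toLp 2 ((z : H), A z)) (A.mem_graph z)
      simpa [WithLp.prod_inner_apply] using this
    have hform (z : A.domain) : inner ℂ (-w.fst) (z : H) = inner ℂ w.snd (A z) := by
      rw [inner_neg_left, neg_eq_iff_add_eq_zero, hw' z]
    have hdom : w.snd ∈ A.adjoint.domain := mem_adjoint_domain_of_exists _ ⟨_, hform⟩
    have h := hx ⟨_, hdom⟩
    rw [adjoint_apply_eq hdense ⟨_, hdom⟩ hform, inner_neg_left, neg_eq_zero] at h
    simp [WithLp.prod_inner_apply, h]
  rw [Submodule.orthogonal_orthogonal_eq_closure, hGc.submodule_topologicalClosure_eq] at hmem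
  exact hmem

/-- If `g = A u` with `u` orthogonal to the kernel of `A`, then `u` lies in the closure of
every subspace of `(ker A)ᗮ` in which `A x = g` has bounded approximate solutions. -/
theorem LinearPMap.mem_topologicalClosure_of_bounded_residual {H : Type*} [NormedAddCommGroup H]
    [InnerProductSpace ℂ H] [CompleteSpace H] (A : H →ₗ.[ℂ] H)
    (hdense : Dense (A.domain : Set H)) (hclosed : A.IsClosed) (K Z : Submodule ℂ H)
    [Z.HasOrthogonalProjection] (hZ : ∀ x, x ∈ Z ↔ (x, (0 : H)) ∈ A.graph) (hK : K ≤ Zᗮ)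
    {u : H} (hu : u ∈ Zᗮ) {C : ℝ}
    (happrox : ∀ ε > 0, ∃ e : A.domain, u - e ∈ K ∧ ‖(e : H)‖ ≤ C ∧ ‖A e‖ ≤ ε) :
    u ∈ K.topologicalClosure := by
  have hC : 0 ≤ C := by
    obtain ⟨e, -, he, -⟩ := happrox 1 one_pos
    exact (norm_nonneg _).trans he
  let R : Submodule ℂ H := LinearMap.range A.adjoint.toFun
  have hRZ : Zᗮ ≤ R.topologicalClosure := by
    rw [← Submodule.orthogonal_orthogonal_eq_closure]
    refine Submodule.orthogonal_le fun x hx => (hZ x).2 ?_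
    refine A.exists_apply_eq_zero_of_inner_adjoint_eq_zero hdense hclosed fun y => ?_
    exact (Submodule.mem_orthogonal _ _).1 hx _ ⟨y, rfl⟩
  rw [← Submodule.orthogonal_orthogonal_eq_closure, Submodule.mem_orthogonal]
  intro w hw
  rw [Submodule.mem_orthogonal'] at hw
  have hw₁ : w - Z.starProjection w ∈ _root_.closure (R : Set H) :=
    hRZ (Z.sub_starProjection_mem_orthogonal w)
  rw [← norm_le_zero_iff]
  refine le_of_forall_pos_le_add fun δ hδ => ?_
  rw [zero_add]
  obtain ⟨_, ⟨y, rfl⟩, hy⟩ := Metric.mem_closure_iff.1 hw₁ (δ / (2 * (C + 1))) (by positivity)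
  obtain ⟨e, heK, heC, heA⟩ := happrox (δ / (2 * (‖(y : H)‖ + 1))) (by positivity)
  have heZ : (e : H) ∈ Zᗮ := by
    have := sub_mem hu (hK heK)
    rwa [sub_sub_cancel] at this
  have h₁ : inner ℂ w u = inner ℂ (w - Z.starProjection w - A.adjoint y) (e : H) +
      inner ℂ (y : H) (A e) := by
    have h := hw _ heK
    rw [inner_sub_right, sub_eq_zero] at h
    rw [h, inner_sub_left, inner_sub_left,
      (Submodule.mem_orthogonal _ _).1 heZ _ (Z.starProjection_apply_mem w),
      adjoint_isFormalAdjoint hdense y e]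
    ring
  rw [h₁]
  rw [dist_eq_norm] at hy
  calc _ ≤ ‖w - Z.starProjection w - A.adjoint y‖ * ‖(e : H)‖ + ‖(y : H)‖ * ‖A e‖ :=
        norm_add_le_of_le (norm_inner_le_norm _ _) (norm_inner_le_norm _ _)
    _ ≤ δ / (2 * (C + 1)) * (C + 1) +
        (‖(y : H)‖ + 1) * (δ / (2 * (‖(y : H)‖ + 1))) := by
        refine add_le_add (mul_le_mul hy.le (by linarith) (norm_nonneg _) (by positivity))
          (mul_le_mul (by linarith) heA (norm_nonneg _) (by positivity))
    _ = δ := by field_simp; norm_num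

end Residual

/-- Let `A` be a densely defined closed operator on a complex Hilbert space `H`, and let
`g ∈ ran A ∩ dom A*`. Then there exists `u ∈ dom (A*A)` (i.e. `u ∈ dom A` with
`A u ∈ dom A*`) such that `A u = g`, so that `A* g = A* A u ∈ ran (A*A)`. If moreover
`A* g` is a quasi-analytic vector for `A*A` — here the orbit `v n = (A*A)ⁿ (A* g)` is
encoded by a sequence `v` with `v 0 = A* g` and `v (n+1) = A* A (v n)` (so in particular
`A* g ∈ dom ((A*A)ⁿ)` for all `n`), and quasi-analyticity means that the series
`∑_{n ≥ 1} ‖(A*A)ⁿ A* g‖^(-1/n)` diverges to `+∞` — then there exists a unique `f` in the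
closure of the Krylov subspace `K(A*A, A* g) = span {v n : n ∈ ℕ}` with `f ∈ dom (A*A)` and
`A* A f = A* g`, and this `f` moreover satisfies `A f = g`. -/
theorem krylov_solution_of_normal_equation
    {H : Type*} [NormedAddCommGroup H] [InnerProductSpace ℂ H] [CompleteSpace H]
    (A : H →ₗ.[ℂ] H) (hdense : Dense (A.domain : Set H)) (hclosed : A.IsClosed)
    (g : H) (hg : ∃ u : A.domain, A u = g) (hgdom : g ∈ A.adjoint.domain)
    (v : ℕ → H) (hv0 : v 0 = A.adjoint ⟨g, hgdom⟩)
    (hv : ∀ n : ℕ, ∃ (h₁ : v n ∈ A.domain) (h₂ : A ⟨v n, h₁⟩ ∈ A.adjoint.domain),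
      A.adjoint ⟨A ⟨v n, h₁⟩, h₂⟩ = v (n + 1))
    (hqa : Filter.Tendsto
      (fun N => ∑ n ∈ Finset.range N, ‖v (n + 1)‖ ^ (-(1 : ℝ) / ((n : ℝ) + 1)))
      Filter.atTop Filter.atTop) :
    (∃ (u : H) (hu : u ∈ A.domain) (hu' : A ⟨u, hu⟩ ∈ A.adjoint.domain),
      A ⟨u, hu⟩ = g ∧
      A.adjoint ⟨A ⟨u, hu⟩, hu'⟩ = A.adjoint ⟨g, hgdom⟩) ∧
    (∃! f : H, f ∈ (Submodule.span ℂ (Set.range v)).topologicalClosure ∧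
      ∃ (hf : f ∈ A.domain) (hf' : A ⟨f, hf⟩ ∈ A.adjoint.domain),
        A.adjoint ⟨A ⟨f, hf⟩, hf'⟩ = A.adjoint ⟨g, hgdom⟩ ∧
        A ⟨f, hf⟩ = g) := by
  set K := Submodule.span ℂ (Set.range v)
  set Z : Submodule ℂ H := A.graph.comap (LinearMap.inl ℂ H H)
  have hZ (x : H) : x ∈ Z ↔ (x, (0 : H)) ∈ A.graph := Iff.rfl
  have hZc : IsClosed (Z : Set H) :=
    hclosed.preimage (by fun_prop : Continuous fun x : H => (x, (0 : H)))
  have : CompleteSpace Z := hZc.completeSpace_coe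
  have hadjZ (y : A.adjoint.domain) : A.adjoint y ∈ Zᗮ := by
    rw [Submodule.mem_orthogonal']
    intro z hz
    obtain ⟨z', rfl, hz'⟩ := A.mem_graph_iff.1 ((hZ z).1 hz)
    rw [LinearPMap.adjoint_isFormalAdjoint hdense y z', hz', inner_zero_right]
  have hvZ (n : ℕ) : v n ∈ Zᗮ := by
    cases n with
    | zero => exact hv0 ▸ hadjZ _
    | succ n =>
      obtain ⟨_, _, h⟩ := hv n
      exact h ▸ hadjZ _
  have hKZ : K ≤ Zᗮ := Submodule.span_le.2 (by rintro _ ⟨n, rfl⟩; exact hvZ n)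
  have hKcZ : K.topologicalClosure ≤ Zᗮ :=
    Submodule.topologicalClosure_minimal _ hKZ (Submodule.isClosed_orthogonal _)
  obtain ⟨u₀, hu₀⟩ := hg
  obtain ⟨u, huZ, hu, hAu⟩ : ∃ u ∈ Zᗮ, ∃ hu : u ∈ A.domain, A ⟨u, hu⟩ = g := by
    have h := sub_mem (A.mem_graph u₀) ((hZ _).1 (Z.starProjection_apply_mem (u₀ : H)))
    obtain ⟨u, hu, hAu⟩ := A.mem_graph_iff.1 h
    refine ⟨_, Z.sub_starProjection_mem_orthogonal (u₀ : H), ?_⟩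
    simp only [Prod.mk_sub_mk, sub_zero, hu₀] at hu hAu
    rw [← hu]
    exact ⟨u.2, hAu⟩
  have hu' : A ⟨u, hu⟩ ∈ A.adjoint.domain := hAu ▸ hgdom
  have hAAu : A.adjoint ⟨A ⟨u, hu⟩, hu'⟩ = A.adjoint ⟨g, hgdom⟩ := by
    congr 1
    exact Subtype.ext hAu
  refine ⟨⟨u, hu, hu', hAu, hAAu⟩, u, ⟨?_, hu, hu', hAAu, hAu⟩, ?_⟩
  · let s : ℕ → H := fun n => Nat.casesOn n u v
    have hs (n : ℕ) : ∃ (h₁ : s n ∈ A.domain) (h₂ : A ⟨s n, h₁⟩ ∈ A.adjoint.domain),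
        A.adjoint ⟨A ⟨s n, h₁⟩, h₂⟩ = s (n + 1) := by
      cases n with
      | zero => exact ⟨hu, hu', hAAu.trans hv0.symm⟩
      | succ n => exact hv n
    have hsum : ¬ Summable fun n : ℕ => ‖s (n + 2)‖ ^ (-(1 : ℝ) / ((n : ℝ) + 1)) :=
      (not_summable_iff_tendsto_nat_atTop_of_nonneg fun n =>
        Real.rpow_nonneg (norm_nonneg _) _).2 hqa
    refine A.mem_topologicalClosure_of_bounded_residual hdense hclosed K Z hZ hKZ huZ
      (C := ‖u‖ ^ 2 + 1) fun ε hε => ?_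
    obtain ⟨e, heK, he, hAe⟩ := exists_bounded_residual A hdense s hs hsum (sq_pos_of_pos hε)
    refine ⟨e, heK, ?_, (sq_le_sq₀ (norm_nonneg _) hε.le).1 hAe⟩
    change ‖(e : H)‖ ^ 2 ≤ ‖u‖ ^ 2 + 1 at he
    nlinarith [sq_nonneg ‖u‖, norm_nonneg (e : H)]
  · rintro f ⟨hfK, hf, hf', -, hAf⟩
    have hZ' : f - u ∈ Z := by
      have h := sub_mem (A.mem_graph ⟨f, hf⟩) (A.mem_graph ⟨u, hu⟩)
      simpa [hZ, hAf, hAu] using h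
    have h := (Submodule.mem_orthogonal _ _).1 (sub_mem (hKcZ hfK) huZ) _ hZ'
    exact sub_eq_zero.1 (inner_self_eq_zero.1 h)
end
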